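/- arXiv:1305.1752 — 2 statements merged into one kernel-verified Lean document; each statement's English description precedes it below -/
import Mathlib

section
/- Let L be a finite geometric lattice, R a ring with 1, D = (U_0, (U_a)) an orthogonal atomic datum over R with respect to L, d_0 a compatible section for D with Coxeter numbers h^x, and V = O(D, L). Then there exists a unique family of R-linear maps d_{x;y} : V_x → V_y, indexed by pairs x ⋖ y with x ≠ ⊥ and y indecomposable, with the following property: defining for each indecomposable z ∈ L and i > 0 the map d_i^z : V_{≤z,i} → V_{≤z,i+1} as the direct sum of the maps d_{x;y} over x ≤ z with rk(x) = i and indecomposable y ≤ z with x ⋖ y, and d_0^z := π_{≤z} ∘ d_0 restricted to U^z, one has ∂_y ∘ d_{x;y} = h^y · id_{V_x} − d^y_{rk(x)−1} ∘ ∂_x for all pairs ⊥ ≠ x ⋖ y with y indecomposable; moreover, for every indecomposable z ∈ L, the maps (1/h^z) d^z form an L_{≤z}-homotopy for the complex V_{≤z} = O(D_{≤z}, L_{≤z}). -/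
/-- A finite lattice is atomistic: every element is a join (finite sup) of atoms. -/
def Atomistic (L : Type*) [Lattice L] [OrderBot L] : Prop :=
  ∀ x : L, ∃ s : Finset L, (∀ a ∈ s, IsAtom a) ∧ s.sup id = x

/-- Semimodularity: whenever `a ⊓ b` is covered by `a`, `b` is covered by `a ⊔ b`. -/
def Semimodular (L : Type*) [Lattice L] : Prop :=
  ∀ a b : L, a ⊓ b ⋖ a → b ⋖ a ⊔ b

/-- `rk` is the rank function: it vanishes at `⊥` and increases by one along covers. -/
def IsRankFunction {L : Type*} [Lattice L] [OrderBot L] (rk : L → ℕ) : Prop :=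
  rk ⊥ = 0 ∧ ∀ x y : L, x ⋖ y → rk y = rk x + 1

/-- An element `x ≠ ⊥` is decomposable if `x = y ⊔ z` with `y, z ≠ ⊥` such that every atom
below `x` lies below exactly one of `y` and `z`. -/
def Decomposable {L : Type*} [Lattice L] [OrderBot L] (x : L) : Prop :=
  ∃ y z : L, y ≠ ⊥ ∧ z ≠ ⊥ ∧ y ⊔ z = x ∧
    ∀ a : L, IsAtom a → a ≤ x → Xor' (a ≤ y) (a ≤ z)

/-- An element is indecomposable if it is `≠ ⊥` and not decomposable. -/
def Indecomposable {L : Type*} [Lattice L] [OrderBot L] (x : L) : Prop :=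
  x ≠ ⊥ ∧ ¬ Decomposable x

section ComplexDefs

variable {R : Type*} [Ring R] {L : Type*} [Lattice L] [BoundedOrder L]

/-- A compatible `L`-grading on a chain complex `(V, d)` of `R`-modules:
`d` squares to zero, the graded piece `V_x` lives in degree `rk x` (we record a piece in every
degree, which is `⊥` off the rank), each degree is the internal direct sum of its pieces, and
the differential maps `V_x` into `⊕_{y ⋖ x} V_y`. -/
def IsCompatGrading [DecidableEq L] (rk : L → ℕ) (V : ℕ → Type*)
    [∀ i, AddCommGroup (V i)] [∀ i, Module R (V i)]
    (d : ∀ i, V (i + 1) →ₗ[R] V i) (Vx : L → ∀ i, Submodule R (V i)) : Prop :=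
  (∀ (i : ℕ) (v : V (i + 2)), d i (d (i + 1) v) = 0) ∧
  (∀ (x : L) (i : ℕ), i ≠ rk x → Vx x i = ⊥) ∧
  (∀ i : ℕ, DirectSum.IsInternal (fun x : L => Vx x i)) ∧
  (∀ (i : ℕ) (x : L), rk x = i + 1 →
    Submodule.map (d i) (Vx x (i + 1)) ≤ ⨆ y ∈ {y : L | y ⋖ x}, Vx y i)

/-- The degree-`i` part of the subcomplex `V_{≤ x}`. -/
def Vle {V : ℕ → Type*} [∀ i, AddCommGroup (V i)] [∀ i, Module R (V i)]
    (Vx : L → ∀ i, Submodule R (V i)) (x : L) (i : ℕ) : Submodule R (V i) :=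
  ⨆ y ∈ {y : L | y ≤ x}, Vx y i

/-- Acyclicity of the subcomplex `V_{≤x}`: `Ker ∂_j = Im ∂_{j+1}` at all positions `j ≥ 1`. -/
def AcyclicOn {V : ℕ → Type*} [∀ i, AddCommGroup (V i)] [∀ i, Module R (V i)]
    (d : ∀ i, V (i + 1) →ₗ[R] V i) (Vx : L → ∀ i, Submodule R (V i)) (x : L) : Prop :=
  ∀ i : ℕ, Vle Vx x (i + 1) ⊓ LinearMap.ker (d i) =
    Submodule.map (d (i + 1)) (Vle Vx x (i + 2))

/-- Acyclicity of the complex: `Ker ∂_j = Im ∂_{j+1}` at all positions `j ≥ 1`. -/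
def Acyclic {V : ℕ → Type*} [∀ i, AddCommGroup (V i)] [∀ i, Module R (V i)]
    (d : ∀ i, V (i + 1) →ₗ[R] V i) : Prop :=
  ∀ i : ℕ, LinearMap.ker (d i) = LinearMap.range (d (i + 1))

/-- `(V, d, Vx)` is the minimal complex of its atomic datum `(V_⊥, (∂(V_a))_a)`:
the bottom piece is everything in degree `0`, the differential is injective on each atom piece,
and for `rk x ≥ 2` the differential is injective on `V_x` with image exactly the kernel of
`∂` on `V_{≺x} = ⊕_{y ⋖ x} V_y`. -/
def IsMinimal (rk : L → ℕ) {V : ℕ → Type*} [∀ i, AddCommGroup (V i)] [∀ i, Module R (V i)]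
    (d : ∀ i, V (i + 1) →ₗ[R] V i) (Vx : L → ∀ i, Submodule R (V i)) : Prop :=
  Vx ⊥ 0 = ⊤ ∧
  (∀ a : L, IsAtom a → ∀ v ∈ Vx a 1, d 0 v = 0 → v = 0) ∧
  (∀ (i : ℕ) (x : L), rk x = i + 2 →
    (∀ v ∈ Vx x (i + 2), d (i + 1) v = 0 → v = 0) ∧
    Submodule.map (d (i + 1)) (Vx x (i + 2)) =
      (⨆ y ∈ {y : L | y ⋖ x}, Vx y (i + 1)) ⊓ LinearMap.ker (d i))

/-- The subcomplex `V_{≤x}` admits an `L_{≤x}`-homotopy: a contracting homotopy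
(`h0` on the image of `∂_1`, `h j` in positions `j ≥ 1`) which moves each graded piece `V_z`
(`⊥ ≠ z ≤ x`) into `⊕_{y ⋗ z, y ≤ x} V_y`. -/
def HasLHomotopyOn (rk : L → ℕ) {V : ℕ → Type*} [∀ i, AddCommGroup (V i)]
    [∀ i, Module R (V i)] (d : ∀ i, V (i + 1) →ₗ[R] V i)
    (Vx : L → ∀ i, Submodule R (V i)) (x : L) : Prop :=
  ∃ (hmem : ∀ (i : ℕ) (v : V (i + 1)), v ∈ Vle Vx x (i + 1) → d i v ∈ Vle Vx x i)
    (h0 : ↥(Submodule.map (d 0) (Vle Vx x 1)) →ₗ[R] V 1)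
    (h : ∀ i : ℕ, ↥(Vle Vx x (i + 1)) →ₗ[R] V (i + 2)),
    (∀ v : ↥(Vle Vx x 1),
      d 1 (h 0 v) + h0 ⟨d 0 v.1, Submodule.mem_map_of_mem v.2⟩ = v.1) ∧
    (∀ (i : ℕ) (v : ↥(Vle Vx x (i + 2))),
      d (i + 2) (h (i + 1) v) + h i ⟨d (i + 1) v.1, hmem (i + 1) v.1 v.2⟩ = v.1) ∧
    (∀ (i : ℕ) (z : L), z ≤ x → rk z = i + 1 →
      ∀ v : ↥(Vle Vx x (i + 1)), v.1 ∈ Vx z (i + 1) →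
        h i v ∈ ⨆ y ∈ {y : L | z ⋖ y ∧ y ≤ x}, Vx y (i + 2))

/-- The complex is `L`-contractible: every subcomplex `V_{≤x}` admits an `L_{≤x}`-homotopy. -/
def LContractible (rk : L → ℕ) {V : ℕ → Type*} [∀ i, AddCommGroup (V i)]
    [∀ i, Module R (V i)] (d : ∀ i, V (i + 1) →ₗ[R] V i)
    (Vx : L → ∀ i, Submodule R (V i)) : Prop :=
  ∀ x : L, HasLHomotopyOn rk d Vx x

end ComplexDefs

section Stmt10

variable {R : Type*} [Ring R] {L : Type*} [Lattice L] [BoundedOrder L]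

/-- The map `d_i^z` built out of a family `D = (d_{x;y})`: the direct sum over pairs
`x ⋖ y` with `x, y ≤ z`, `rk x = j + 1` and `y` indecomposable of the compositions of the
projection onto the graded piece `V_x` with `d_{x;y} : V_x → V_y`. -/
noncomputable def dSum [Fintype L]
    [DecidableRel ((· ≤ ·) : L → L → Prop)]
    [DecidableRel ((· ⋖ ·) : L → L → Prop)]
    [DecidablePred (fun x : L => Indecomposable x)]
    (rk : L → ℕ) {V : ℕ → Type*} [∀ i, AddCommGroup (V i)] [∀ i, Module R (V i)]
    (Vx : L → ∀ i, Submodule R (V i))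
    (proj : L → ∀ i, V i →ₗ[R] V i)
    (hpp : ∀ (x : L) (j : ℕ), rk x = j + 1 → ∀ v : V (j + 1), proj x (j + 1) v ∈ Vx x (j + 1))
    (D : ∀ (i : ℕ) (x y : L), ↥(Vx x (i + 1)) →ₗ[R] V (i + 2)) (z : L) (j : ℕ) :
    V (j + 1) →ₗ[R] V (j + 2) :=
  ∑ x : L, ∑ y : L,
    if hx : rk x = j + 1 then
      if x ≤ z ∧ y ≤ z ∧ x ⋖ y ∧ Indecomposable y then
        (D j x y).comp (LinearMap.codRestrict (Vx x (j + 1)) (proj x (j + 1)) (hpp x j hx))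
      else 0
    else 0

section LatticeLemmas

theorem IsRankFunction.strictMono [Finite L] {rk : L → ℕ} (hrk : IsRankFunction rk) :
    StrictMono rk := by
  intro x y hxy
  induction x using WellFoundedGT.induction with
  | ind x ih =>
    obtain ⟨c, hxc, hcy⟩ := exists_covBy_le_of_lt hxy
    have h := hrk.2 x c hxc
    rcases hcy.eq_or_lt with rfl | hlt
    · omega
    · have := ih c hxc.lt hlt
      omega

theorem IsRankFunction.eq_of_le [Finite L] {rk : L → ℕ} (hrk : IsRankFunction rk) {x y : L}
    (h : x ≤ y) (hr : rk x = rk y) : x = y := by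
  by_contra hne
  exact (hrk.strictMono (lt_of_le_of_ne h hne)).ne hr

theorem IsRankFunction.covBy_of_le [Finite L] {rk : L → ℕ} (hrk : IsRankFunction rk) {x y : L}
    (h : x ≤ y) (hr : rk y = rk x + 1) : x ⋖ y := by
  refine ⟨lt_of_le_of_ne h (by rintro rfl; omega), fun c hxc hcy => ?_⟩
  have h1 := hrk.strictMono hxc
  have h2 := hrk.strictMono hcy
  omega

theorem IsRankFunction.isAtom_iff [Finite L] {rk : L → ℕ} (hrk : IsRankFunction rk) {x : L} :
    IsAtom x ↔ rk x = 1 := by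
  rw [← bot_covBy_iff]
  refine ⟨fun h => ?_, fun h => hrk.covBy_of_le bot_le ?_⟩
  · rw [hrk.2 _ _ h, hrk.1]
  · rw [h, hrk.1]

theorem Atomistic.le_of_forall_atom (hL : Atomistic L) {x y : L}
    (h : ∀ a : L, IsAtom a → a ≤ x → a ≤ y) : x ≤ y := by
  obtain ⟨s, hs, rfl⟩ := hL x
  exact Finset.sup_le fun a ha => h a (hs a ha) (Finset.le_sup (f := id) ha)

theorem Atomistic.exists_atom_le (hL : Atomistic L) {x : L} (hx : x ≠ ⊥) :
    ∃ a : L, IsAtom a ∧ a ≤ x := by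
  by_contra! h
  exact hx (le_bot_iff.1 (hL.le_of_forall_atom fun a ha hax => absurd hax (h a ha)))

theorem Semimodular.covBy_sup_atom (hL : Semimodular L) {x a : L} (ha : IsAtom a)
    (hax : ¬ a ≤ x) : x ⋖ x ⊔ a := by
  rw [sup_comm]
  refine hL a x ?_
  rwa [(ha.not_le_iff_disjoint.1 hax).eq_bot, bot_covBy_iff]

theorem Indecomposable.of_isAtom {a : L} (ha : IsAtom a) : Indecomposable a := by
  refine ⟨ha.1, ?_⟩
  rintro ⟨y, z, hy, hz, hyz, hxor⟩
  have h1 : y = a := (ha.le_iff.1 (hyz ▸ le_sup_left)).resolve_left hy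
  have h2 : z = a := (ha.le_iff.1 (hyz ▸ le_sup_right)).resolve_left hz
  subst h1
  subst h2
  simpa using (show Xor _ _ from hxor _ ha le_rfl)

theorem Indecomposable.le_or_le (hL : Atomistic L) {x y₁ y₂ : L} (hx : Indecomposable x)
    (hxor : ∀ a : L, IsAtom a → a ≤ y₁ ⊔ y₂ → Xor (a ≤ y₁) (a ≤ y₂)) (hle : x ≤ y₁ ⊔ y₂) :
    x ≤ y₁ ∨ x ≤ y₂ := by
  by_contra! h
  refine hx.2 ⟨x ⊓ y₁, x ⊓ y₂, fun h1 => h.2 ?_, fun h2 => h.1 ?_, ?_, fun a ha hax => ?_⟩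
  · refine hL.le_of_forall_atom fun a ha hax => ?_
    rcases hxor a ha (hax.trans hle) with ⟨h3, -⟩ | ⟨h3, -⟩
    · exact absurd (le_bot_iff.1 (h1 ▸ le_inf hax h3)) ha.1
    · exact h3
  · refine hL.le_of_forall_atom fun a ha hax => ?_
    rcases hxor a ha (hax.trans hle) with ⟨h3, -⟩ | ⟨h3, -⟩
    · exact h3
    · exact absurd (le_bot_iff.1 (h2 ▸ le_inf hax h3)) ha.1
  · refine le_antisymm (sup_le inf_le_left inf_le_left)
      (hL.le_of_forall_atom fun a ha hax => ?_)
    rcases hxor a ha (hax.trans hle) with ⟨h3, -⟩ | ⟨h3, -⟩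
    · exact (le_inf hax h3).trans le_sup_left
    · exact (le_inf hax h3).trans le_sup_right
  · change Xor _ _
    simpa [le_inf_iff, hax] using hxor a ha (hax.trans hle)

theorem lt_sup_of_forall_xor (hL : Atomistic L) {y₁ y₂ : L} (hy₂ : y₂ ≠ ⊥)
    (hxor : ∀ a : L, IsAtom a → a ≤ y₁ ⊔ y₂ → Xor (a ≤ y₁) (a ≤ y₂)) : y₁ < y₁ ⊔ y₂ := by
  obtain ⟨c, hc, hcy⟩ := hL.exists_atom_le hy₂
  refine lt_of_le_of_ne le_sup_left fun h => ?_
  have h1 : c ≤ y₁ := h ▸ hcy.trans le_sup_right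
  exact absurd (hxor c hc (h1.trans le_sup_left)) (by simp [Xor, h1, hcy])

/-- An indecomposable element covered by `y₁ ⊔ y₂`, where `y₁` and `y₂` split the atoms, is
one of the two summands. -/
theorem Indecomposable.eq_or_eq_of_covBy (hL : Atomistic L) {x y₁ y₂ : L} (hx : Indecomposable x)
    (hy₁ : y₁ ≠ ⊥) (hy₂ : y₂ ≠ ⊥)
    (hxor : ∀ a : L, IsAtom a → a ≤ y₁ ⊔ y₂ → Xor (a ≤ y₁) (a ≤ y₂)) (hcov : x ⋖ y₁ ⊔ y₂) :
    x = y₁ ∨ x = y₂ := by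
  have key : ∀ {u v : L}, v ≠ ⊥ → (∀ a : L, IsAtom a → a ≤ u ⊔ v → Xor (a ≤ u) (a ≤ v)) →
      x ⋖ u ⊔ v → x ≤ u → x = u := fun hv huv hc hxu =>
    (hc.eq_or_eq hxu le_sup_left).elim Eq.symm
      fun h => absurd h (lt_sup_of_forall_xor hL hv huv).ne
  refine (hx.le_or_le hL hxor hcov.le).imp (key hy₂ hxor hcov) (key hy₁ (fun a ha h => ?_) ?_)
  · exact (xor_comm _ _).mp (hxor a ha (sup_comm y₁ y₂ ▸ h))
  · rwa [sup_comm]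

theorem Indecomposable.exists_complement (hL : Atomistic L) {x y : L} (hx : Indecomposable x)
    (hcov : x ⋖ y) (hy : Decomposable y) :
    ∃ z : L, z ≠ ⊥ ∧ x ⊔ z = y ∧ ∀ a : L, IsAtom a → a ≤ y → Xor (a ≤ x) (a ≤ z) := by
  obtain ⟨y₁, y₂, h₁, h₂, rfl, hxor⟩ := hy
  rcases hx.eq_or_eq_of_covBy hL h₁ h₂ hxor hcov with rfl | rfl
  · exact ⟨y₂, h₂, rfl, hxor⟩
  · exact ⟨y₁, h₁, sup_comm _ _, fun a ha h => (xor_comm _ _).mp (hxor a ha h)⟩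

theorem Indecomposable.decomposable_sup_atom (hL : Atomistic L) (hsemi : Semimodular L)
    {x a a' : L} (hx : Indecomposable x) (ha : IsAtom a) (ha' : IsAtom a') (hax : a ≤ x)
    (hax' : ¬ a' ≤ x) (hdec : Decomposable (x ⊔ a')) : Decomposable (a ⊔ a') := by
  obtain ⟨z, hz, hxz, hxor⟩ := hx.exists_complement hL (hsemi.covBy_sup_atom ha' hax') hdec
  have hle : a ⊔ a' ≤ x ⊔ a' := sup_le_sup_right hax a'
  have haz : ¬ a ≤ z := by simpa [Xor, hax] using hxor a ha (hax.trans le_sup_left)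
  have haz' : a' ≤ z := by simpa [Xor, hax'] using hxor a' ha' le_sup_right
  have hne : ∀ {b c : L}, IsAtom b → IsAtom c → b ≠ c → ¬ b ≤ c := fun hb hc h h' =>
    h ((hc.le_iff.1 h').resolve_left hb.1)
  have exch : ∀ {b c e : L}, IsAtom b → IsAtom c → IsAtom e → b ≠ c → b ≠ e → e ≤ b ⊔ c →
      c ≤ b ⊔ e := by
    intro b c e hb hc he hbc hbe hle
    have h1 := hsemi.covBy_sup_atom hc (hne hc hb hbc.symm)
    have h2 := hsemi.covBy_sup_atom he (hne he hb hbe.symm)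
    rcases h1.eq_or_eq h2.le (sup_le le_sup_left hle) with h | h
    · exact absurd h h2.lt.ne'
    · exact h ▸ le_sup_right
  have haa' : a ≠ a' := by rintro rfl; exact hax' hax
  refine ⟨a, a', ha.1, ha'.1, rfl, fun b hb hba => ?_⟩
  rcases hxor b hb (hba.trans hle) with ⟨h1, -⟩ | ⟨h1, h2⟩
  · have : a = b := by
      by_contra h
      exact hax' ((exch ha ha' hb haa' h hba).trans (sup_le hax h1))
    subst this
    exact Or.inl ⟨le_rfl, hne ha ha' haa'⟩
  · have : a' = b := by
      by_contra h
      exact haz ((exch ha' ha hb haa'.symm h (sup_comm a a' ▸ hba)).trans (sup_le haz' h1))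
    subst this
    exact Or.inr ⟨le_rfl, hne ha' ha haa'.symm⟩

theorem Indecomposable.inf_eq_bot_of_covBy (hL : Atomistic L) {x x' y : L}
    (hx : Indecomposable x) (hx' : Indecomposable x') (hne : x ≠ x') (hxy : x ⋖ y)
    (hxy' : x' ⋖ y) (hy : Decomposable y) : x ⊓ x' = ⊥ := by
  obtain ⟨z, hz, rfl, hxor⟩ := hx.exists_complement hL hxy hy
  have h := (hx'.eq_or_eq_of_covBy hL hx.1 hz hxor hxy').resolve_left hne.symm
  by_contra hb
  obtain ⟨a, ha, hle⟩ := hL.exists_atom_le hb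
  have h1 := hle.trans inf_le_left
  exact absurd (hxor a ha (h1.trans le_sup_left))
    (by simp [Xor, h1, h ▸ hle.trans inf_le_right])

end LatticeLemmas

section GradedLemmas

theorem mem_Vle {P : Type*} [Lattice P] {V : ℕ → Type*} [∀ i, AddCommGroup (V i)]
    [∀ i, Module R (V i)] {Vx : P → ∀ i, Submodule R (V i)} {x z : P} {i : ℕ} (hxz : x ≤ z) {v : V i} (hv : v ∈ Vx x i) : v ∈ Vle Vx z i :=
  Submodule.mem_iSup_of_mem x (Submodule.mem_iSup_of_mem hxz hv)

theorem Vle_mono {P : Type*} [Lattice P] {V : ℕ → Type*} [∀ i, AddCommGroup (V i)]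
    [∀ i, Module R (V i)] {Vx : P → ∀ i, Submodule R (V i)} {x z : P} (hxz : x ≤ z) (i : ℕ) : Vle Vx x i ≤ Vle Vx z i :=
  biSup_mono fun _ hy => le_trans hy hxz

theorem biSup_covBy_le_Vle {P : Type*} [Lattice P] {V : ℕ → Type*} [∀ i, AddCommGroup (V i)]
    [∀ i, Module R (V i)] {Vx : P → ∀ i, Submodule R (V i)} (x : P) (i : ℕ) : ⨆ y ∈ {y : P | y ⋖ x}, Vx y i ≤ Vle Vx x i :=
  biSup_mono fun _ hy => CovBy.le hy

/-- A minimal complex of an orthogonal atomic datum over a geometric lattice, together with its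
canonical projections. -/
structure OrthogonalMinimalComplex [DecidableEq L] (rk : L → ℕ) {V : ℕ → Type*}
    [∀ i, AddCommGroup (V i)] [∀ i, Module R (V i)] (d : ∀ i, V (i + 1) →ₗ[R] V i)
    (Vx : L → ∀ i, Submodule R (V i)) (proj : L → ∀ i, V i →ₗ[R] V i) : Prop where
  atomistic : Atomistic L
  semimodular : Semimodular L
  isRank : IsRankFunction rk
  grading : IsCompatGrading rk V d Vx
  minimal : IsMinimal rk d Vx
  orthogonal : ∀ a b : L, IsAtom a → IsAtom b → a ≠ b → Decomposable (a ⊔ b) →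
    Submodule.map (d 0) (Vx a 1) ⊓ Submodule.map (d 0) (Vx b 1) = ⊥
  proj_of_le : ∀ (z : L) (i : ℕ) (y : L), y ≤ z → ∀ v ∈ Vx y i, proj z i v = v
  proj_of_not_le : ∀ (z : L) (i : ℕ) (y : L), ¬ y ≤ z → ∀ v ∈ Vx y i, proj z i v = 0
  proj_mem : ∀ (x : L) (j : ℕ), rk x = j + 1 → ∀ v : V (j + 1), proj x (j + 1) v ∈ Vx x (j + 1)

namespace OrthogonalMinimalComplex

variable [DecidableEq L] {rk : L → ℕ} {V : ℕ → Type*} [∀ i, AddCommGroup (V i)]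
  [∀ i, Module R (V i)] {d : ∀ i, V (i + 1) →ₗ[R] V i} {Vx : L → ∀ i, Submodule R (V i)}
  {proj : L → ∀ i, V i →ₗ[R] V i}

theorem eq_zero_of_rank_ne (H : OrthogonalMinimalComplex rk d Vx proj) {x : L} {i : ℕ}
    (hi : rk x ≠ i) {v : V i} (hv : v ∈ Vx x i) : v = 0 := by
  have h := H.grading.2.1 x i (Ne.symm hi)
  rw [h] at hv
  exact (Submodule.mem_bot R).1 hv

theorem mem_induction (H : OrthogonalMinimalComplex rk d Vx proj) {i : ℕ} {p : V i → Prop}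
    (mem : ∀ x : L, rk x = i → ∀ v ∈ Vx x i, p v) (zero : p 0)
    (add : ∀ u v, p u → p v → p (u + v)) (v : V i) : p v := by
  have hv : v ∈ ⨆ x : L, Vx x i := by
    rw [(H.grading.2.2.1 i).submodule_iSup_eq_top]
    trivial
  refine Submodule.iSup_induction (fun x : L => Vx x i) (motive := p) hv
    (fun x u hu => ?_) zero add
  by_cases hx : rk x = i
  · exact mem x hx u hu
  · rw [H.eq_zero_of_rank_ne hx hu]
    exact zero

theorem biSup_induction (H : OrthogonalMinimalComplex rk d Vx proj) {i : ℕ} {s : Set L}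
    {p : V i → Prop} (mem : ∀ x ∈ s, rk x = i → ∀ v ∈ Vx x i, p v) (zero : p 0)
    (add : ∀ u v, p u → p v → p (u + v)) {v : V i} (hv : v ∈ ⨆ x ∈ s, Vx x i) : p v := by
  refine Submodule.iSup_induction (fun x : L => ⨆ (_ : x ∈ s), Vx x i) (motive := p) hv
    (fun x u hu => ?_) zero add
  by_cases hs : x ∈ s
  · rw [iSup_pos hs] at hu
    by_cases hx : rk x = i
    · exact mem x hs hx u hu
    · rw [H.eq_zero_of_rank_ne hx hu]
      exact zero
  · rw [iSup_neg hs, Submodule.mem_bot] at hu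
    rw [hu]
    exact zero

theorem d_mem (H : OrthogonalMinimalComplex rk d Vx proj) {x : L} {i : ℕ} {v : V (i + 1)}
    (hv : v ∈ Vx x (i + 1)) : d i v ∈ ⨆ y ∈ {y : L | y ⋖ x}, Vx y i := by
  by_cases hx : rk x = i + 1
  · exact H.grading.2.2.2 i x hx (Submodule.mem_map_of_mem hv)
  · rw [H.eq_zero_of_rank_ne hx hv, map_zero]
    exact zero_mem _

theorem d_mem_Vle (H : OrthogonalMinimalComplex rk d Vx proj) {z : L} {i : ℕ} {v : V (i + 1)}
    (hv : v ∈ Vle Vx z (i + 1)) : d i v ∈ Vle Vx z i := by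
  refine H.biSup_induction (p := fun v => d i v ∈ Vle Vx z i) (fun x hx _ u hu => ?_)
    (by simp) (fun u w hu hw => by rw [map_add]; exact add_mem hu hw) hv
  exact Vle_mono hx i (biSup_covBy_le_Vle x i (H.d_mem hu))

theorem proj_of_mem_Vle (H : OrthogonalMinimalComplex rk d Vx proj) {z : L} {i : ℕ} {v : V i}
    (hv : v ∈ Vle Vx z i) : proj z i v = v :=
  H.biSup_induction (p := fun v => proj z i v = v)
    (fun x hx _ u hu => H.proj_of_le z i x hx u hu) (map_zero _)
    (fun u w hu hw => by rw [map_add, hu, hw]) hv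

theorem proj_mem_Vle (H : OrthogonalMinimalComplex rk d Vx proj) (z : L) (i : ℕ) (v : V i) :
    proj z i v ∈ Vle Vx z i := by
  refine H.mem_induction (p := fun v => proj z i v ∈ Vle Vx z i) (fun x _ u hu => ?_) (by simp)
    (fun u w hu hw => by rw [map_add]; exact add_mem hu hw) v
  by_cases hx : x ≤ z
  · rw [H.proj_of_le z i x hx u hu]
    exact mem_Vle hx hu
  · rw [H.proj_of_not_le z i x hx u hu]
    exact zero_mem _

variable [Fintype L]

theorem d_injOn (H : OrthogonalMinimalComplex rk d Vx proj) {x : L} {i : ℕ} {v : V (i + 1)}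
    (hv : v ∈ Vx x (i + 1)) (h : d i v = 0) : v = 0 := by
  by_cases hx : rk x = i + 1
  · cases i with
    | zero => exact H.minimal.2.1 x (H.isRank.isAtom_iff.2 hx) v hv h
    | succ i => exact (H.minimal.2.2 i x hx).1 v hv h
  · exact H.eq_zero_of_rank_ne hx hv

theorem d_inj_iff (H : OrthogonalMinimalComplex rk d Vx proj) {x : L} {i : ℕ} {v w : V (i + 1)}
    (hv : v ∈ Vx x (i + 1)) (hw : w ∈ Vx x (i + 1)) (h : d i v = d i w) : v = w :=
  sub_eq_zero.1 (H.d_injOn (sub_mem hv hw) (by rw [map_sub, h, sub_self]))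

/-- The piece of a minimal complex at a decomposable element vanishes. -/
theorem eq_zero_of_decomposable (H : OrthogonalMinimalComplex rk d Vx proj) (i : ℕ) :
    ∀ x : L, Decomposable x → ∀ v ∈ Vx x (i + 1), v = 0 := by
  induction i with
  | zero =>
    intro x hx v hv
    exact H.eq_zero_of_rank_ne
      (fun h => (Indecomposable.of_isAtom (H.isRank.isAtom_iff.2 h)).2 hx) hv
  | succ i ih =>
    rintro x ⟨y₁, y₂, h₁, h₂, rfl, hxor⟩ v hv
    refine H.d_injOn hv ?_
    have hle : ⨆ w ∈ {w : L | w ⋖ y₁ ⊔ y₂}, Vx w (i + 1) ≤ Vx y₁ (i + 1) ⊔ Vx y₂ (i + 1) := by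
      refine iSup₂_le fun w hw => ?_
      by_cases hwd : Decomposable w
      · intro u hu
        rw [ih w hwd u hu]
        exact zero_mem _
      · by_cases hwb : w = ⊥
        · intro u hu
          rw [H.eq_zero_of_rank_ne (by rw [hwb, H.isRank.1]; omega) hu]
          exact zero_mem _
        · rcases Indecomposable.eq_or_eq_of_covBy H.atomistic ⟨hwb, hwd⟩ h₁ h₂ hxor hw with
            rfl | rfl
          · exact le_sup_left
          · exact le_sup_right
    obtain ⟨v₁, hv₁, v₂, hv₂, hsum⟩ := Submodule.mem_sup.1 (hle (H.d_mem hv))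
    have hd : d i v₁ = - d i v₂ := by
      rw [eq_neg_iff_add_eq_zero, ← map_add, hsum]
      exact H.grading.1 i v
    suffices h0 : d i v₁ = 0 by
      rw [← hsum, H.d_injOn hv₁ h0, H.d_injOn hv₂ (by rw [h0, eq_comm, neg_eq_zero] at hd; exact hd),
        add_zero]
    have hdisj : ∀ w, w ≤ y₁ → w ≤ y₂ → w = ⊥ := by
      intro w hw₁ hw₂
      by_contra hw
      obtain ⟨a, ha, haw⟩ := H.atomistic.exists_atom_le hw
      exact absurd (hxor a ha (haw.trans (hw₁.trans le_sup_left)))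
        (show ¬ Xor _ _ by simp [Xor, haw.trans hw₁, haw.trans hw₂])
    cases i with
    | zero =>
      by_cases hr₁ : rk y₁ = 1
      swap
      · rw [H.eq_zero_of_rank_ne hr₁ hv₁, map_zero]
      by_cases hr₂ : rk y₂ = 1
      swap
      · rw [hd, H.eq_zero_of_rank_ne hr₂ hv₂, map_zero, neg_zero]
      have hmem : d 0 v₁ ∈ Submodule.map (d 0) (Vx y₁ 1) ⊓ Submodule.map (d 0) (Vx y₂ 1) :=
        ⟨Submodule.mem_map_of_mem hv₁, hd ▸ neg_mem (Submodule.mem_map_of_mem hv₂)⟩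
      rw [H.orthogonal y₁ y₂ (H.isRank.isAtom_iff.2 hr₁) (H.isRank.isAtom_iff.2 hr₂) ?_
        ⟨y₁, y₂, h₁, h₂, rfl, hxor⟩] at hmem
      · exact (Submodule.mem_bot R).1 hmem
      · rintro rfl
        exact h₁ (hdisj _ le_rfl le_rfl)
    | succ i =>
      have hm₁ := H.d_mem_Vle (mem_Vle le_rfl hv₁)
      have hm₂ : d (i + 1) v₁ ∈ Vle Vx y₂ (i + 1) :=
        hd ▸ neg_mem (H.d_mem_Vle (mem_Vle le_rfl hv₂))
      rw [← H.proj_of_mem_Vle hm₁]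
      refine H.biSup_induction (p := fun v => proj y₁ (i + 1) v = 0) (fun w hw hwr u hu => ?_)
        (map_zero _) (fun u w hu hw => by rw [map_add, hu, hw, add_zero]) hm₂
      refine H.proj_of_not_le y₁ _ w (fun hwy => ?_) u hu
      rw [hdisj w hwy hw, H.isRank.1] at hwr
      omega

theorem Vle_le_biSup_covBy (H : OrthogonalMinimalComplex rk d Vx proj) {y : L} {i : ℕ}
    (hy : rk y = i + 1) : Vle Vx y i ≤ ⨆ x ∈ {x : L | x ⋖ y}, Vx x i := by
  refine iSup₂_le fun x hx u hu => ?_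
  by_cases hxr : rk x = i
  · exact Submodule.mem_iSup_of_mem x
      (Submodule.mem_iSup_of_mem (H.isRank.covBy_of_le hx (by omega)) hu)
  · rw [H.eq_zero_of_rank_ne hxr hu]
    exact zero_mem _

/-- An integer annihilating `∂ V_a` for all atoms `a ≤ x` annihilates every piece below `x`. -/
theorem zsmul_eq_zero (H : OrthogonalMinimalComplex rk d Vx proj) {x : L} {n : ℤ}
    (hn : ∀ a : L, IsAtom a → a ≤ x → ∀ v ∈ Vx a 1, n • d 0 v = 0) (i : ℕ) :
    ∀ w ≤ x, ∀ v ∈ Vx w (i + 1), n • v = 0 := by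
  induction i with
  | zero =>
    intro w hw v hv
    refine H.d_injOn (zsmul_mem hv n) ?_
    rw [map_zsmul]
    by_cases hwr : rk w = 1
    · exact hn w (H.isRank.isAtom_iff.2 hwr) hw v hv
    · rw [H.eq_zero_of_rank_ne hwr hv, map_zero, smul_zero]
  | succ i ih =>
    intro w hw v hv
    refine H.d_injOn (zsmul_mem hv n) ?_
    rw [map_zsmul]
    exact H.biSup_induction (p := fun v => n • v = 0)
      (fun y hy _ u hu => ih y ((CovBy.le hy).trans hw) u hu) (smul_zero _)
      (fun u w hu hw => by rw [smul_add, hu, hw, add_zero]) (H.d_mem hv)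

variable [DecidableRel ((· ≤ ·) : L → L → Prop)]

theorem proj_eq_sum (H : OrthogonalMinimalComplex rk d Vx proj) (z : L) (i : ℕ) (v : V i) :
    proj z i v = ∑ x : L, if rk x = i ∧ x ≤ z then proj x i v else 0 := by
  refine H.mem_induction (p := fun v => proj z i v =
    ∑ x : L, if rk x = i ∧ x ≤ z then proj x i v else 0) (fun w hw u hu => ?_) (by simp)
    (fun u w hu hw => ?_) v
  · rw [Finset.sum_eq_single w]
    · rw [H.proj_of_le w i w le_rfl u hu]
      split_ifs with h
      · exact H.proj_of_le z i w h.2 u hu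
      · exact H.proj_of_not_le z i w (fun h' => h ⟨hw, h'⟩) u hu
    · intro x _ hxw
      split_ifs with h
      · refine H.proj_of_not_le x i w (fun h' => hxw ?_) u hu
        exact (H.isRank.eq_of_le h' (hw.trans h.1.symm)).symm
      · rfl
    · simp
  · rw [map_add, hu, hw, ← Finset.sum_add_distrib]
    refine Finset.sum_congr rfl fun x _ => ?_
    split_ifs <;> simp

variable [DecidableRel ((· ⋖ ·) : L → L → Prop)] [DecidablePred (fun x : L => Indecomposable x)]

/-- If the components of `t` at pieces not below `x` are supported on those `x'` for which
`x ⊔ x'` is an indecomposable cover of `x`, then `π_{≤z} t` is recovered from `π_{≤x} t` and the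
`π_{≤y} t` with `y ≤ z` an indecomposable cover of `x`. -/
theorem proj_eq_add_sum (H : OrthogonalMinimalComplex rk d Vx proj) {x z : L} (hxz : x ≤ z)
    {i : ℕ} {t : V i}
    (ht : ∀ x' : L, rk x' = i → x' ≤ z → ¬ x' ≤ x →
      ¬ (x ⋖ x ⊔ x' ∧ Indecomposable (x ⊔ x')) → proj x' i t = 0) :
    proj z i t = proj x i t +
      ∑ y : L, if y ≤ z ∧ x ⋖ y ∧ Indecomposable y then proj y i t - proj x i t else 0 := by
  have key : ∀ x' : L, (if rk x' = i ∧ x' ≤ z then proj x' i t else 0) =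
      (if rk x' = i ∧ x' ≤ x then proj x' i t else 0) +
      ∑ y : L, if y ≤ z ∧ x ⋖ y ∧ Indecomposable y then
        (if rk x' = i ∧ x' ≤ y then proj x' i t else 0) -
        (if rk x' = i ∧ x' ≤ x then proj x' i t else 0) else 0 := by
    intro x'
    by_cases hr : rk x' = i
    swap
    · simp [hr]
    simp only [hr, true_and]
    by_cases hx : x' ≤ x
    · rw [if_pos (hx.trans hxz), if_pos hx, Finset.sum_eq_zero, add_zero]
      intro y _
      split_ifs with h1 h2
      · exact sub_self _
      · exact absurd (hx.trans h1.2.1.le) h2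
      · rfl
    simp only [if_neg hx, sub_zero, zero_add]
    rw [Finset.sum_eq_single (x ⊔ x')]
    · by_cases hz : x' ≤ z
      · rw [if_pos hz, if_pos le_sup_right]
        split_ifs with h
        · rfl
        · exact ht x' hr hz hx fun h' => h ⟨sup_le hxz hz, h'⟩
      · rw [if_neg hz, if_neg fun h => hz (le_sup_right.trans h.1)]
    · intro y _ hy
      split_ifs with h1 h2
      · refine absurd ((h1.2.1.eq_or_eq le_sup_left (sup_le h1.2.1.le h2)).resolve_left ?_) hy.symm
        exact fun h => hx (h ▸ le_sup_right)
      · rfl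
      · rfl
    · simp
  rw [H.proj_eq_sum z, Finset.sum_congr rfl fun x' _ => key x', Finset.sum_add_distrib,
    ← H.proj_eq_sum x, Finset.sum_comm]
  congr 1
  refine Finset.sum_congr rfl fun y _ => ?_
  split_ifs with h
  · rw [Finset.sum_sub_distrib, ← H.proj_eq_sum, ← H.proj_eq_sum]
  · simp


end OrthogonalMinimalComplex

variable {V : ℕ → Type*} [∀ i, AddCommGroup (V i)] [∀ i, Module R (V i)]

open Classical in
/-- A linear lift of `f` along `∂` into the graded piece at `y`, if there is one. -/
noncomputable def pieceLift (d : ∀ i, V (i + 1) →ₗ[R] V i) (Vx : L → ∀ i, Submodule R (V i))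
    (y : L) (i : ℕ) {M : Type*} [AddCommGroup M] [Module R M] (f : M →ₗ[R] V i) :
    M →ₗ[R] V (i + 1) :=
  if h : ∃ g : M →ₗ[R] V (i + 1), (∀ m, g m ∈ Vx y (i + 1)) ∧ ∀ m, d i (g m) = f m then
    h.choose
  else 0

section Recursion

variable [Fintype L] [DecidableRel ((· ≤ ·) : L → L → Prop)]
  [DecidableRel ((· ⋖ ·) : L → L → Prop)] [DecidablePred (fun x : L => Indecomposable x)]

/-- The maps `d_{x;y}` obtained by lifting `h^y - π_{≤y} ∘ T` along `∂_y`. -/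
noncomputable def coverMap (rk : L → ℕ) (d : ∀ i, V (i + 1) →ₗ[R] V i)
    (Vx : L → ∀ i, Submodule R (V i)) (proj : L → ∀ i, V i →ₗ[R] V i) (hcox : L → ℤ) (i : ℕ)
    (T : V (i + 1) →ₗ[R] V (i + 1)) (x y : L) : ↥(Vx x (i + 1)) →ₗ[R] V (i + 2) :=
  if rk x = i + 1 ∧ x ⋖ y ∧ Indecomposable y then
    pieceLift d Vx y (i + 1)
      (hcox y • (Vx x (i + 1)).subtype - ((proj y (i + 1)).comp T).comp (Vx x (i + 1)).subtype)
  else 0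

/-- The degree-`j` version of `dSum`, for a family of maps in that degree only. -/
noncomputable def levelSum (rk : L → ℕ) (Vx : L → ∀ i, Submodule R (V i))
    (proj : L → ∀ i, V i →ₗ[R] V i)
    (hpp : ∀ (x : L) (j : ℕ), rk x = j + 1 → ∀ v : V (j + 1), proj x (j + 1) v ∈ Vx x (j + 1))
    (j : ℕ) (E : ∀ x y : L, ↥(Vx x (j + 1)) →ₗ[R] V (j + 2)) (z : L) :
    V (j + 1) →ₗ[R] V (j + 2) :=
  ∑ x : L, ∑ y : L,
    if hx : rk x = j + 1 then
      if x ≤ z ∧ y ≤ z ∧ x ⋖ y ∧ Indecomposable y then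
        (E x y).comp (LinearMap.codRestrict (Vx x (j + 1)) (proj x (j + 1)) (hpp x j hx))
      else 0
    else 0

/-- The endomorphisms `d_i ∘ ∂_{i+1}` of `V_{i+1}` built recursively from `d_0`. -/
noncomputable def homotopyEnd (rk : L → ℕ) (d : ∀ i, V (i + 1) →ₗ[R] V i)
    (Vx : L → ∀ i, Submodule R (V i)) (proj : L → ∀ i, V i →ₗ[R] V i)
    (hpp : ∀ (x : L) (j : ℕ), rk x = j + 1 → ∀ v : V (j + 1), proj x (j + 1) v ∈ Vx x (j + 1))
    (hcox : L → ℤ) (d0 : ↥(LinearMap.range (d 0)) →ₗ[R] V 1) :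
    ∀ i : ℕ, V (i + 1) →ₗ[R] V (i + 1)
  | 0 => d0.comp (d 0).rangeRestrict
  | j + 1 =>
    (levelSum rk Vx proj hpp j
      (coverMap rk d Vx proj hcox j (homotopyEnd rk d Vx proj hpp hcox d0 j)) ⊤).comp (d (j + 1))

end Recursion

namespace OrthogonalMinimalComplex

variable [DecidableEq L] [Fintype L] {rk : L → ℕ} {d : ∀ i, V (i + 1) →ₗ[R] V i}
  {Vx : L → ∀ i, Submodule R (V i)} {proj : L → ∀ i, V i →ₗ[R] V i}

theorem pieceLift_spec (H : OrthogonalMinimalComplex rk d Vx proj) {y : L} {i : ℕ}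
    (hy : rk y = i + 2) {M : Type*} [AddCommGroup M] [Module R M] (f : M →ₗ[R] V (i + 1))
    (hf : ∀ m, f m ∈ Vle Vx y (i + 1)) (hdf : ∀ m, d i (f m) = 0) :
    (∀ m, pieceLift d Vx y (i + 1) f m ∈ Vx y (i + 2)) ∧
      ∀ m, d (i + 1) (pieceLift d Vx y (i + 1) f m) = f m := by
  have hex : ∃ g : M →ₗ[R] V (i + 2), (∀ m, g m ∈ Vx y (i + 2)) ∧ ∀ m, d (i + 1) (g m) = f m := by
    let e : ↥(Vx y (i + 2)) →ₗ[R] V (i + 1) := (d (i + 1)).comp (Vx y (i + 2)).subtype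
    have he : Function.Injective e := by
      intro u v huv
      exact Subtype.ext (H.d_inj_iff u.2 v.2 huv)
    have hfe : ∀ m, f m ∈ LinearMap.range e := by
      intro m
      have hm : f m ∈ Submodule.map (d (i + 1)) (Vx y (i + 2)) := by
        rw [(H.minimal.2.2 i y hy).2]
        exact ⟨H.Vle_le_biSup_covBy hy (hf m), hdf m⟩
      obtain ⟨u, hu, hum⟩ := hm
      exact ⟨⟨u, hu⟩, hum⟩
    refine ⟨((Vx y (i + 2)).subtype.comp (LinearEquiv.ofInjective e he).symm.toLinearMap).comp
      (f.codRestrict _ hfe), fun m => Subtype.coe_prop _, fun m => ?_⟩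
    have h := LinearEquiv.apply_symm_apply (LinearEquiv.ofInjective e he) (f.codRestrict _ hfe m)
    exact congrArg Subtype.val h
  rw [pieceLift, dif_pos hex]
  exact hex.choose_spec

/-- The properties of the endomorphism `d_i ∘ ∂_{i+1}` which propagate through the recursion. -/
structure IsHomotopyEnd (rk : L → ℕ) (d : ∀ i, V (i + 1) →ₗ[R] V i)
    (Vx : L → ∀ i, Submodule R (V i)) (proj : L → ∀ i, V i →ₗ[R] V i) (hcox : L → ℤ) (i : ℕ)
    (T : V (i + 1) →ₗ[R] V (i + 1)) : Prop where
  d_proj : ∀ z : L, Indecomposable z → ∀ v ∈ Vle Vx z (i + 1),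
    d i (proj z (i + 1) (T v)) = hcox z • d i v
  proj_eq_zero : ∀ x x' : L, rk x = i + 1 → rk x' = i + 1 → x ≠ x' →
    ¬ (x ⋖ x ⊔ x' ∧ Indecomposable (x ⊔ x')) → ∀ v ∈ Vx x (i + 1), proj x' (i + 1) (T v) = 0
  apply_d : ∀ v : V (i + 2), T (d (i + 1) v) = 0

variable {hcox : L → ℤ} {i : ℕ} {T : V (i + 1) →ₗ[R] V (i + 1)}

theorem proj_self (H : OrthogonalMinimalComplex rk d Vx proj)
    (hT : IsHomotopyEnd rk d Vx proj hcox i T) {x : L} (hxr : rk x = i + 1)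
    (hx : Indecomposable x) {v : V (i + 1)} (hv : v ∈ Vx x (i + 1)) :
    proj x (i + 1) (T v) = hcox x • v :=
  H.d_inj_iff (H.proj_mem x i hxr _) (zsmul_mem hv _)
    (by rw [hT.d_proj x hx v (mem_Vle le_rfl hv), map_zsmul])

theorem isHomotopyEnd_zero (H : OrthogonalMinimalComplex rk d Vx proj)
    {d0 : ↥(LinearMap.range (d 0)) →ₗ[R] V 1}
    (hsec1 : ∀ x : L, Indecomposable x → ∀ u : ↥(LinearMap.range (d 0)),
      (u : V 0) ∈ Submodule.map (d 0) (Vle Vx x 1) →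
      d 0 (proj x 1 (d0 u)) = hcox x • (u : V 0))
    (hsec2 : ∀ a a' : L, IsAtom a → IsAtom a' → Decomposable (a ⊔ a') →
      ∀ u : ↥(LinearMap.range (d 0)), (u : V 0) ∈ Submodule.map (d 0) (Vx a 1) →
      proj a' 1 (d0 u) = 0) :
    IsHomotopyEnd rk d Vx proj hcox 0 (d0.comp (d 0).rangeRestrict) where
  d_proj z hz v hv := hsec1 z hz _ (Submodule.mem_map_of_mem hv)
  proj_eq_zero x x' hx hx' hne hcov v hv := by
    have ha := H.isRank.isAtom_iff.2 hx
    have ha' := H.isRank.isAtom_iff.2 hx'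
    have hc : x ⋖ x ⊔ x' := H.semimodular.covBy_sup_atom ha' fun h =>
      hne (H.isRank.eq_of_le h (hx'.trans hx.symm)).symm
    refine hsec2 x x' ha ha' ?_ _ (Submodule.mem_map_of_mem hv)
    by_contra hd
    exact hcov ⟨hc, (lt_of_le_of_lt bot_le hc.lt).ne', hd⟩
  apply_d v := by
    have h : (d 0).rangeRestrict (d 1 v) = 0 := Subtype.ext (H.grading.1 0 v)
    rw [LinearMap.comp_apply, h, map_zero]

variable [DecidableRel ((· ⋖ ·) : L → L → Prop)] [DecidablePred (fun x : L => Indecomposable x)]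

theorem coverMap_spec (H : OrthogonalMinimalComplex rk d Vx proj)
    (hT : IsHomotopyEnd rk d Vx proj hcox i T) {x y : L} (hx : rk x = i + 1) (hxy : x ⋖ y)
    (hy : Indecomposable y) (v : ↥(Vx x (i + 1))) :
    coverMap rk d Vx proj hcox i T x y v ∈ Vx y (i + 2) ∧
      d (i + 1) (coverMap rk d Vx proj hcox i T x y v) =
        hcox y • (v : V (i + 1)) - proj y (i + 1) (T v) := by
  rw [coverMap, if_pos ⟨hx, hxy, hy⟩]
  have h := H.pieceLift_spec (by rw [H.isRank.2 x y hxy, hx])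
    (hcox y • (Vx x (i + 1)).subtype - ((proj y (i + 1)).comp T).comp (Vx x (i + 1)).subtype)
    (fun m => ?_) (fun m => ?_)
  · exact ⟨h.1 v, h.2 v⟩
  · exact sub_mem (zsmul_mem (mem_Vle hxy.le m.2) _) (H.proj_mem_Vle _ _ _)
  · change d i (hcox y • (m : V (i + 1)) - proj y (i + 1) (T m)) = 0
    rw [map_sub, map_zsmul, hT.d_proj y hy m (mem_Vle hxy.le m.2), sub_self]

theorem coverMap_mem (H : OrthogonalMinimalComplex rk d Vx proj)
    (hT : IsHomotopyEnd rk d Vx proj hcox i T) (x y : L) (v : ↥(Vx x (i + 1))) :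
    coverMap rk d Vx proj hcox i T x y v ∈ Vx y (i + 2) := by
  by_cases h : rk x = i + 1 ∧ x ⋖ y ∧ Indecomposable y
  · exact (H.coverMap_spec hT h.1 h.2.1 h.2.2 v).1
  · rw [coverMap, if_neg h]
    exact zero_mem _

variable [DecidableRel ((· ≤ ·) : L → L → Prop)]

theorem levelSum_apply_of_mem (H : OrthogonalMinimalComplex rk d Vx proj) {j : ℕ}
    (E : ∀ x y : L, ↥(Vx x (j + 1)) →ₗ[R] V (j + 2)) (z : L) {x : L} (hx : rk x = j + 1)
    {v : V (j + 1)} (hv : v ∈ Vx x (j + 1)) :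
    levelSum rk Vx proj H.proj_mem j E z v =
      ∑ y : L, if y ≤ z ∧ x ⋖ y ∧ Indecomposable y then E x y ⟨v, hv⟩ else 0 := by
  rw [levelSum, LinearMap.sum_apply, Finset.sum_eq_single x]
  · rw [LinearMap.sum_apply]
    refine Finset.sum_congr rfl fun y _ => ?_
    rw [dif_pos hx]
    by_cases h : y ≤ z ∧ x ⋖ y ∧ Indecomposable y
    · rw [if_pos h, if_pos ⟨h.2.1.le.trans h.1, h⟩, LinearMap.comp_apply]
      exact congrArg (E x y) (Subtype.ext (H.proj_of_le x _ x le_rfl v hv))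
    · rw [if_neg h, if_neg fun h' => h h'.2, LinearMap.zero_apply]
  · intro w _ hwx
    rw [LinearMap.sum_apply]
    refine Finset.sum_eq_zero fun y _ => ?_
    split_ifs with h1 h2
    · rw [LinearMap.comp_apply]
      have h0 : LinearMap.codRestrict (Vx w (j + 1)) (proj w (j + 1)) (H.proj_mem w j h1) v = 0 :=
        Subtype.ext (H.proj_of_not_le w _ x
          (fun h => hwx (H.isRank.eq_of_le h (hx.trans h1.symm)).symm) v hv)
      rw [h0, map_zero]
    · rfl
    · rfl
  · simp

theorem proj_levelSum (H : OrthogonalMinimalComplex rk d Vx proj) {j : ℕ}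
    {E : ∀ x y : L, ↥(Vx x (j + 1)) →ₗ[R] V (j + 2)} (hE : ∀ x y v, E x y v ∈ Vx y (j + 2))
    (z : L) (v : V (j + 1)) :
    proj z (j + 2) (levelSum rk Vx proj H.proj_mem j E ⊤ v) =
      levelSum rk Vx proj H.proj_mem j E z v := by
  refine H.mem_induction (p := fun v => proj z (j + 2) (levelSum rk Vx proj H.proj_mem j E ⊤ v) =
      levelSum rk Vx proj H.proj_mem j E z v) (fun x hx v hv => ?_) (by simp)
    (fun u w hu hw => by simp only [map_add, hu, hw]) v
  rw [H.levelSum_apply_of_mem E ⊤ hx hv, H.levelSum_apply_of_mem E z hx hv, map_sum]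
  refine Finset.sum_congr rfl fun y _ => ?_
  by_cases hc : x ⋖ y ∧ Indecomposable y
  · rw [if_pos ⟨le_top, hc⟩]
    split_ifs with h
    · exact H.proj_of_le z _ y h.1 _ (hE x y _)
    · exact H.proj_of_not_le z _ y (fun h' => h ⟨h', hc⟩) _ (hE x y _)
  · rw [if_neg fun h => hc h.2, if_neg fun h => hc h.2, map_zero]

theorem levelSum_mem (H : OrthogonalMinimalComplex rk d Vx proj) {j : ℕ}
    {E : ∀ x y : L, ↥(Vx x (j + 1)) →ₗ[R] V (j + 2)} (hE : ∀ x y v, E x y v ∈ Vx y (j + 2))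
    (z : L) {x : L} (hx : rk x = j + 1) {v : V (j + 1)} (hv : v ∈ Vx x (j + 1)) :
    levelSum rk Vx proj H.proj_mem j E z v ∈ ⨆ y ∈ {y : L | x ⋖ y ∧ y ≤ z}, Vx y (j + 2) := by
  rw [H.levelSum_apply_of_mem E z hx hv]
  refine sum_mem fun y _ => ?_
  split_ifs with h
  · exact Submodule.mem_iSup_of_mem y (Submodule.mem_iSup_of_mem ⟨h.2.1, h.1⟩ (hE x y _))
  · exact zero_mem _

/-- The relation between the Coxeter numbers of `z`, of `x ≤ z`, and of the indecomposable
covers of `x` below `z`, as far as it is seen by the piece `V_x`. -/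
theorem hcox_smul (H : OrthogonalMinimalComplex rk d Vx proj)
    {T₀ : V 1 →ₗ[R] V 1} (hT₀ : IsHomotopyEnd rk d Vx proj hcox 0 T₀) {x z : L}
    (hx : Indecomposable x) (hz : Indecomposable z) (hxz : x ≤ z) {v : V (i + 1)}
    (hv : v ∈ Vx x (i + 1)) :
    hcox z • v = hcox x • v +
      ∑ y : L, if y ≤ z ∧ x ⋖ y ∧ Indecomposable y then hcox y • v - hcox x • v else 0 := by
  have hn : ∀ {M : Type _} [AddCommGroup M] (m : M),
      (hcox z - (hcox x +
        ∑ y : L, if y ≤ z ∧ x ⋖ y ∧ Indecomposable y then hcox y - hcox x else 0)) • m =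
      hcox z • m - (hcox x • m +
        ∑ y : L, if y ≤ z ∧ x ⋖ y ∧ Indecomposable y then hcox y • m - hcox x • m else 0) := by
    intro M _ m
    rw [sub_smul, add_smul, Finset.sum_smul]
    congr 2
    refine Finset.sum_congr rfl fun y _ => ?_
    split_ifs
    · rw [sub_smul]
    · rw [zero_smul]
  rw [← sub_eq_zero, ← hn v]
  refine H.zsmul_eq_zero (x := x) (fun a ha hax u hu => ?_) i x le_rfl v hv
  rw [hn, sub_eq_zero, ← hT₀.d_proj z hz u (mem_Vle (hax.trans hxz) hu),
    ← hT₀.d_proj x hx u (mem_Vle hax hu), H.proj_eq_add_sum hxz (t := T₀ u), map_add, map_sum]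
  · congr 1
    refine Finset.sum_congr rfl fun y _ => ?_
    split_ifs with h
    · rw [map_sub, hT₀.d_proj y h.2.2 u (mem_Vle (hax.trans h.2.1.le) hu)]
    · rw [map_zero]
  · intro x' hx' _ hx'x hne
    have ha' := H.isRank.isAtom_iff.2 hx'
    have hcov := H.semimodular.covBy_sup_atom ha' hx'x
    have hdec : Decomposable (x ⊔ x') := by
      by_contra hd
      exact hne ⟨hcov, (lt_of_le_of_lt bot_le hcov.lt).ne', hd⟩
    have hdec' := hx.decomposable_sup_atom H.atomistic H.semimodular ha ha' hax hx'x hdec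
    exact hT₀.proj_eq_zero a x' (H.isRank.isAtom_iff.1 ha) hx' (by rintro rfl; exact hx'x hax)
      (fun h => h.2.2 hdec') u hu

/-- The homotopy identity in degree `i + 1` of `V_{≤z}`. -/
theorem homotopy_identity (H : OrthogonalMinimalComplex rk d Vx proj)
    {T₀ : V 1 →ₗ[R] V 1} (hT₀ : IsHomotopyEnd rk d Vx proj hcox 0 T₀)
    (hT : IsHomotopyEnd rk d Vx proj hcox i T) {z : L} (hz : Indecomposable z) {v : V (i + 1)}
    (hv : v ∈ Vle Vx z (i + 1)) :
    d (i + 1) (levelSum rk Vx proj H.proj_mem i (coverMap rk d Vx proj hcox i T) z v) +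
      proj z (i + 1) (T v) = hcox z • v := by
  refine H.biSup_induction (p := fun v =>
    d (i + 1) (levelSum rk Vx proj H.proj_mem i (coverMap rk d Vx proj hcox i T) z v) +
      proj z (i + 1) (T v) = hcox z • v) (fun x hxz hxr v hv => ?_) (by simp)
    (fun u w hu hw => by rw [smul_add, ← hu, ← hw]; simp only [map_add]; abel) hv
  by_cases hxd : Decomposable x
  · rw [H.eq_zero_of_decomposable i x hxd v hv]
    simp
  have hx : Indecomposable x := ⟨by rintro rfl; rw [H.isRank.1] at hxr; omega, hxd⟩
  rw [H.levelSum_apply_of_mem _ z hxr hv, H.proj_eq_add_sum hxz (t := T v),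
    H.hcox_smul hT₀ hx hz hxz hv, H.proj_self hT hxr hx hv, map_sum, add_left_comm,
    ← Finset.sum_add_distrib]
  · congr 1
    refine Finset.sum_congr rfl fun y _ => ?_
    split_ifs with h
    · rw [(H.coverMap_spec hT hxr h.2.1 h.2.2 ⟨v, hv⟩).2]
      abel
    · rw [map_zero, add_zero]
  · intro x' hx' _ hx'x hne
    exact hT.proj_eq_zero x x' hxr hx' (by rintro rfl; exact hx'x le_rfl) hne v hv

theorem isHomotopyEnd_succ (H : OrthogonalMinimalComplex rk d Vx proj)
    {T₀ : V 1 →ₗ[R] V 1} (hT₀ : IsHomotopyEnd rk d Vx proj hcox 0 T₀)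
    (hT : IsHomotopyEnd rk d Vx proj hcox i T) :
    IsHomotopyEnd rk d Vx proj hcox (i + 1)
      ((levelSum rk Vx proj H.proj_mem i (coverMap rk d Vx proj hcox i T) ⊤).comp (d (i + 1))) where
  d_proj z hz v hv := by
    rw [LinearMap.comp_apply, H.proj_levelSum (H.coverMap_mem hT),
      ← H.homotopy_identity hT₀ hT hz (H.d_mem_Vle hv), hT.apply_d, map_zero, add_zero]
  proj_eq_zero x x' hx hx' hne hcov v hv := by
    rw [LinearMap.comp_apply, H.proj_levelSum (H.coverMap_mem hT)]
    by_cases hxd : Decomposable x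
    · rw [H.eq_zero_of_decomposable _ x hxd v hv]
      simp
    have hxi : Indecomposable x := ⟨by rintro rfl; rw [H.isRank.1] at hx; omega, hxd⟩
    refine H.biSup_induction (p := fun u => levelSum rk Vx proj H.proj_mem i
      (coverMap rk d Vx proj hcox i T) x' u = 0) (fun w hw hwr u hu => ?_) (map_zero _)
      (fun u w hu hw => by rw [map_add, hu, hw, add_zero]) (H.d_mem hv)
    rw [H.levelSum_apply_of_mem _ x' hwr hu]
    refine Finset.sum_eq_zero fun y _ => ?_
    split_ifs with h
    swap
    · rfl
    exfalso
    have hwx : w ⋖ x := hw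
    obtain rfl : y = x' := H.isRank.eq_of_le h.1 (by rw [H.isRank.2 w y h.2.1, hwr, hx'])
    have hnle : ¬ x ≤ y := fun h' => hne (H.isRank.eq_of_le h' (hx.trans hx'.symm))
    have hnle' : ¬ y ≤ x := fun h' => hne (H.isRank.eq_of_le h' (hx'.trans hx.symm)).symm
    have hinf : x ⊓ y = w := (hwx.eq_or_eq (le_inf hwx.le h.2.1.le) inf_le_left).resolve_right
      fun h' => hnle (inf_eq_left.1 h')
    have hc₁ : x ⋖ x ⊔ y := by
      rw [sup_comm]
      exact H.semimodular y x (by rw [inf_comm, hinf]; exact h.2.1)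
    have hc₂ : y ⋖ x ⊔ y := H.semimodular x y (by rw [hinf]; exact hwx)
    have hdec : Decomposable (x ⊔ y) := by
      by_contra hd
      exact hcov ⟨hc₁, (lt_of_le_of_lt bot_le hc₁.lt).ne', hd⟩
    have hb := hxi.inf_eq_bot_of_covBy H.atomistic h.2.2 hne hc₁ hc₂ hdec
    rw [← hinf, hb, H.isRank.1] at hwr
    omega
  apply_d v := by rw [LinearMap.comp_apply, H.grading.1, map_zero]

theorem isHomotopyEnd_homotopyEnd (H : OrthogonalMinimalComplex rk d Vx proj)
    {d0 : ↥(LinearMap.range (d 0)) →ₗ[R] V 1}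
    (h0 : IsHomotopyEnd rk d Vx proj hcox 0 (d0.comp (d 0).rangeRestrict)) (i : ℕ) :
    IsHomotopyEnd rk d Vx proj hcox i (homotopyEnd rk d Vx proj H.proj_mem hcox d0 i) := by
  induction i with
  | zero => exact h0
  | succ i ih => exact H.isHomotopyEnd_succ h0 ih

end OrthogonalMinimalComplex

end GradedLemmas

/-- Construction of `L`-homotopies from a compatible section (Proposition on minimal complexes
of orthogonal atomic data): there is a unique family of maps `d_{x;y} : V_x → V_y`
(for `⊥ ≠ x ⋖ y`, `y` indecomposable) satisfying `∂_y ∘ d_{x;y} = h^y·id − d^y_{rk(x)−1} ∘ ∂_x`,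
and for every indecomposable `z` the maps `(1/h^z)·d^z` form an `L_{≤z}`-homotopy
for `V_{≤z}` (stated in the scaled form `∂ d^z + d^z ∂ = h^z · id`). -/
theorem stmt10 {L : Type*} [Lattice L] [Fintype L] [DecidableEq L] [BoundedOrder L]
    [DecidableRel ((· ≤ ·) : L → L → Prop)]
    [DecidableRel ((· ⋖ ·) : L → L → Prop)]
    [DecidablePred (fun x : L => Indecomposable x)]
    (hatom : Atomistic L) (hsemi : Semimodular L)
    (rk : L → ℕ) (hrk : IsRankFunction rk)
    {R : Type*} [Ring R] (V : ℕ → Type*) [∀ i, AddCommGroup (V i)] [∀ i, Module R (V i)]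
    (d : ∀ i, V (i + 1) →ₗ[R] V i) (Vx : L → ∀ i, Submodule R (V i))
    (hgr : IsCompatGrading rk V d Vx) (hmin : IsMinimal rk d Vx)
    -- the atomic datum `(V_⊥, (∂ V_a)_a)` is orthogonal
    (horth : ∀ a b : L, IsAtom a → IsAtom b → a ≠ b → Decomposable (a ⊔ b) →
      Submodule.map (d 0) (Vx a 1) ⊓ Submodule.map (d 0) (Vx b 1) = ⊥)
    -- the canonical projections `π_{≤z}` determined by the internal direct sum decomposition
    (proj : L → ∀ i, V i →ₗ[R] V i)
    (hproj1 : ∀ (z : L) (i : ℕ) (y : L), y ≤ z → ∀ v ∈ Vx y i, proj z i v = v)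
    (hproj2 : ∀ (z : L) (i : ℕ) (y : L), ¬ y ≤ z → ∀ v ∈ Vx y i, proj z i v = 0)
    (hpp : ∀ (x : L) (j : ℕ), rk x = j + 1 → ∀ v : V (j + 1), proj x (j + 1) v ∈ Vx x (j + 1))
    -- a compatible section `d_0 : U^L → ⊕_a U_a ≅ V_1` with Coxeter numbers `h^x`
    (d0 : ↥(LinearMap.range (d 0)) →ₗ[R] V 1)
    (hcox : L → ℤ)
    (hunit : ∀ x : L, Indecomposable x → IsUnit ((hcox x : ℤ) : R))
    (hsec1 : ∀ x : L, Indecomposable x → ∀ u : ↥(LinearMap.range (d 0)),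
      (u : V 0) ∈ Submodule.map (d 0) (Vle Vx x 1) →
      d 0 (proj x 1 (d0 u)) = hcox x • (u : V 0))
    (hsec2 : ∀ a a' : L, IsAtom a → IsAtom a' → Decomposable (a ⊔ a') →
      ∀ u : ↥(LinearMap.range (d 0)), (u : V 0) ∈ Submodule.map (d 0) (Vx a 1) →
      proj a' 1 (d0 u) = 0) :
    ∃! D : ∀ (i : ℕ) (x y : L), ↥(Vx x (i + 1)) →ₗ[R] V (i + 2),
      (∀ (i : ℕ) (x y : L), ¬ (rk x = i + 1 ∧ x ⋖ y ∧ Indecomposable y) → D i x y = 0) ∧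
      (∀ (i : ℕ) (x y : L) (v : ↥(Vx x (i + 1))), D i x y v ∈ Vx y (i + 2)) ∧
      (∀ x y : L, rk x = 1 → x ⋖ y → Indecomposable y → ∀ v : ↥(Vx x 1),
        d 1 (D 0 x y v) = hcox y • (v : V 1) -
          proj y 1 (d0 ⟨d 0 (v : V 1), LinearMap.mem_range_self _ _⟩)) ∧
      (∀ (j : ℕ) (x y : L), rk x = j + 2 → x ⋖ y → Indecomposable y →
        ∀ v : ↥(Vx x (j + 2)),
          d (j + 2) (D (j + 1) x y v) = hcox y • (v : V (j + 2)) -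
            dSum rk Vx proj hpp D y j (d (j + 1) (v : V (j + 2)))) ∧
      (∀ z : L, Indecomposable z →
        (∀ v : V 1, v ∈ Vle Vx z 1 →
          d 1 (dSum rk Vx proj hpp D z 0 v) +
            proj z 1 (d0 ⟨d 0 v, LinearMap.mem_range_self _ _⟩) = hcox z • v) ∧
        (∀ (j : ℕ) (v : V (j + 2)), v ∈ Vle Vx z (j + 2) →
          d (j + 2) (dSum rk Vx proj hpp D z (j + 1) v) +
            dSum rk Vx proj hpp D z j (d (j + 1) v) = hcox z • v) ∧
        (∀ (j : ℕ) (w : L), w ≤ z → rk w = j + 1 → ∀ v ∈ Vx w (j + 1),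
          dSum rk Vx proj hpp D z j v ∈
            ⨆ y ∈ {y : L | w ⋖ y ∧ y ≤ z}, Vx y (j + 2))) := by
  have H : OrthogonalMinimalComplex rk d Vx proj :=
    ⟨hatom, hsemi, hrk, hgr, hmin, horth, hproj1, hproj2, hpp⟩
  have hT₀ := H.isHomotopyEnd_zero hsec1 hsec2
  have hT := H.isHomotopyEnd_homotopyEnd hT₀
  have hE := fun i => H.coverMap_mem (hT i)
  refine ⟨fun i => coverMap rk d Vx proj hcox i (homotopyEnd rk d Vx proj hpp hcox d0 i),
    ⟨fun i x y h => if_neg h, hE, fun x y hx hxy hy v => ?_, fun j x y hx hxy hy v => ?_,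
      fun z hz => ⟨fun v hv => ?_, fun j v hv => ?_, fun j w _ hwr v hv => ?_⟩⟩, ?_⟩
  · exact (H.coverMap_spec (hT 0) hx hxy hy v).2
  · rw [(H.coverMap_spec (hT (j + 1)) hx hxy hy v).2]
    exact congrArg _ (H.proj_levelSum (hE j) y _)
  · exact H.homotopy_identity hT₀ (hT 0) hz hv
  · rw [← H.homotopy_identity hT₀ (hT (j + 1)) hz hv]
    exact congrArg _ (H.proj_levelSum (hE j) z _).symm
  · exact H.levelSum_mem (hE j) z hwr hv
  · rintro D ⟨hD₁, hD₂, hD₃, hD₄, -⟩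
    funext i
    induction i with
    | zero =>
      funext x y
      by_cases h : rk x = 0 + 1 ∧ x ⋖ y ∧ Indecomposable y
      · refine LinearMap.ext fun v => H.d_inj_iff (hD₂ 0 x y v) (hE 0 x y v) ?_
        rw [(H.coverMap_spec (hT 0) h.1 h.2.1 h.2.2 v).2]
        exact hD₃ x y h.1 h.2.1 h.2.2 v
      · rw [hD₁ 0 x y h]
        exact (if_neg h).symm
    | succ j ih =>
      funext x y
      by_cases h : rk x = j + 1 + 1 ∧ x ⋖ y ∧ Indecomposable y
      · refine LinearMap.ext fun v => H.d_inj_iff (hD₂ (j + 1) x y v) (hE (j + 1) x y v) ?_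
        rw [(H.coverMap_spec (hT (j + 1)) h.1 h.2.1 h.2.2 v).2]
        refine (hD₄ j x y h.1 h.2.1 h.2.2 v).trans (congrArg _ ?_)
        change levelSum rk Vx proj hpp j (D j) y _ = _
        rw [ih]
        exact (H.proj_levelSum (hE j) y _).symm
      · rw [hD₁ (j + 1) x y h]
        exact (if_neg h).symm

end Stmt10
end

section
/- Let L and Λ be finite geometric lattices, 0 ≤ k ≤ rk L, l : L_{≥k} → Λ a non-degenerate k-th truncation, R a ring with 1, and V an L-contractible chain complex of R-modules with compatible L-grading. Define the truncated shifted complex V^{(k)} by V^{(k)}_i = V_{i+k} for i ≥ 0 with the differentials inherited from V, graded by Λ via V^{(k)}_λ := ⊕_{x ∈ L_{≥k} : l(x) = λ} V_x for λ ∈ Λ. Then V^{(k)} is a chain complex with compatible Λ-grading and V^{(k)} is Λ-contractible. -/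
theorem IsRankFunction.strictMono_s14 {L : Type*} [Lattice L] [Fintype L] [OrderBot L]
    {rk : L → ℕ} (h : IsRankFunction rk) : StrictMono rk := by
  classical
  let : LocallyFiniteOrder L := Fintype.toLocallyFiniteOrder
  refine (strictMono_iff_forall_covBy rk).2 fun a b hab => ?_
  have := h.2 a b hab
  omega

theorem IsRankFunction.covBy_of_le_s14 {L : Type*} [Lattice L] [Fintype L] [OrderBot L]
    {rk : L → ℕ} (h : IsRankFunction rk) {a b : L} (hab : a ≤ b) (hr : rk b = rk a + 1) :
    a ⋖ b := by
  refine ⟨lt_of_le_of_ne hab ?_, fun c hac hcb => ?_⟩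
  · rintro rfl
    omega
  · have h1 := h.strictMono_s14 hac
    have h2 := h.strictMono_s14 hcb
    omega

section InternalSums

variable {R : Type*} [Ring R] {M : Type*} [AddCommGroup M] [Module R M]

/-- The projection onto a partial sum of an internal direct sum. -/
theorem DirectSum.IsInternal.exists_proj {ι : Type*} [DecidableEq ι] {A : ι → Submodule R M}
    (hA : DirectSum.IsInternal A) (S : Set ι) :
    ∃ p : M →ₗ[R] M, (∀ v, p v ∈ ⨆ x ∈ S, A x) ∧ (∀ v ∈ ⨆ x ∈ S, A x, p v = v) ∧
      ∀ x ∉ S, ∀ v ∈ A x, p v = 0 := by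
  classical
  let e := LinearEquiv.ofBijective (DirectSum.coeLinearMap A) hA
  let p : M →ₗ[R] M :=
    DirectSum.toModule R ι M (fun x => if x ∈ S then (A x).subtype else 0) ∘ₗ e.symm.toLinearMap
  have hp : ∀ x, ∀ v ∈ A x, p v = if x ∈ S then v else 0 := by
    intro x v hv
    have he : e.symm v = DirectSum.lof R ι (fun x => A x) x ⟨v, hv⟩ := by
      rw [LinearEquiv.symm_apply_eq]
      exact (DirectSum.coeLinearMap_lof A x ⟨v, hv⟩).symm
    simp only [p, LinearMap.comp_apply, LinearEquiv.coe_coe, he, DirectSum.toModule_lof]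
    split_ifs <;> simp
  refine ⟨p, fun v => ?_, fun v hv => ?_, fun x hx v hv => by simp [hp x v hv, hx]⟩
  · have htop : (⊤ : Submodule R M) ≤ (⨆ x ∈ S, A x).comap p := by
      rw [← hA.submodule_iSup_eq_top]
      refine iSup_le fun x v hv => ?_
      rw [Submodule.mem_comap, hp x v hv]
      split_ifs with hx
      · exact Submodule.mem_iSup_of_mem x (Submodule.mem_iSup_of_mem hx hv)
      · exact zero_mem _
    exact htop Submodule.mem_top
  · have hle : ⨆ x ∈ S, A x ≤ LinearMap.eqLocus p LinearMap.id := by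
      refine iSup₂_le fun x hx v hv => ?_
      rw [LinearMap.mem_eqLocus, hp x v hv, if_pos hx, LinearMap.id_apply]
    exact hle hv

/-- Grouping the summands of an internal direct sum along a map `f`, where the summands outside
the domain of `f` vanish. -/
theorem DirectSum.IsInternal.fiberwise {ι κ : Type*} [DecidableEq ι] [DecidableEq κ]
    {A : ι → Submodule R M} (hA : DirectSum.IsInternal A) {P : ι → Prop}
    (hP : ∀ x, ¬ P x → A x = ⊥) (f : {x // P x} → κ) :
    DirectSum.IsInternal
      (fun c : κ => ⨆ x : {x // P x}, ⨆ _ : f x = c, A x.1) := by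
  rw [DirectSum.isInternal_submodule_iff_iSupIndep_and_iSup_eq_top]
  refine ⟨fun c => ?_, ?_⟩
  · obtain ⟨p, -, hp, hp0⟩ := hA.exists_proj {x | ∃ hx : P x, f ⟨x, hx⟩ = c}
    rw [Submodule.disjoint_def]
    intro v hv hv'
    have h1 : p v = v := by
      refine hp v ((iSup₂_le fun x hx => ?_ : (_ : Submodule R M) ≤ _) hv)
      exact le_iSup₂_of_le x.1 ⟨x.2, hx⟩ le_rfl
    have h0 : v ∈ LinearMap.ker p := by
      refine (iSup₂_le fun c' hc' => iSup₂_le fun x hx w hw => ?_ : (_ : Submodule R M) ≤ _) hv'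
      exact hp0 x.1 (fun ⟨_, h⟩ => hc' (hx.symm.trans h)) w hw
    rw [← h1]
    exact h0
  · rw [eq_top_iff, ← hA.submodule_iSup_eq_top]
    refine iSup_le fun x => ?_
    by_cases hx : P x
    · exact le_iSup_of_le (f ⟨x, hx⟩) (le_iSup₂_of_le ⟨x, hx⟩ rfl le_rfl)
    · rw [hP x hx]
      exact bot_le

end InternalSums

section Homotopies

variable {R : Type*} [Ring R] {L : Type*} [Lattice L]
  {rk : L → ℕ} {V : ℕ → Type*} [∀ i, AddCommGroup (V i)] [∀ i, Module R (V i)]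
  {d : ∀ i, V (i + 1) →ₗ[R] V i} {Vx : L → ∀ i, Submodule R (V i)} {x : L}

theorem le_Vle {y : L} (h : y ≤ x) (i : ℕ) : Vx y i ≤ Vle Vx x i :=
  le_iSup₂_of_le (f := fun (y : L) (_ : y ∈ {y | y ≤ x}) => Vx y i) y h le_rfl

/-- An `L_{≤ x}`-homotopy extends to maps on the whole complex that vanish outside `V_{≤ x}`. -/
theorem HasLHomotopyOn.exists_extension [DecidableEq L]
    (hint : ∀ i : ℕ, DirectSum.IsInternal (fun x : L => Vx x i))
    (hx : HasLHomotopyOn rk d Vx x) :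
    ∃ h : ∀ i, V (i + 1) →ₗ[R] V (i + 2),
      (∀ i, ∀ v ∈ Vle Vx x (i + 1), d i v = 0 → d (i + 1) (h i v) = v) ∧
      (∀ i, ∀ v ∈ Vle Vx x (i + 2), d (i + 2) (h (i + 1) v) + h i (d (i + 1) v) = v) ∧
      (∀ i z, z ≤ x → rk z = i + 1 → ∀ v ∈ Vx z (i + 1),
        h i v ∈ ⨆ y ∈ {y : L | z ⋖ y ∧ y ≤ x}, Vx y (i + 2)) ∧
      (∀ i z, ¬ z ≤ x → ∀ v ∈ Vx z (i + 1), h i v = 0) := by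
  obtain ⟨hmem, h0, h, H0, H1, H2⟩ := hx
  choose p hp hpid hp0 using fun i => (hint i).exists_proj {y | y ≤ x}
  have hP : ∀ i (v : V i) (hv : v ∈ Vle Vx x i),
      (p i).codRestrict (Vle Vx x i) (hp i) v = ⟨v, hv⟩ :=
    fun i v hv => Subtype.ext (hpid i v hv)
  refine ⟨fun i => h i ∘ₗ (p (i + 1)).codRestrict (Vle Vx x (i + 1)) (hp (i + 1)),
    ?_, ?_, ?_, ?_⟩
  · intro i v hv hdv
    rw [LinearMap.comp_apply, hP _ v hv]
    cases i with
    | zero =>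
      have h1 := H0 ⟨v, hv⟩
      have h2 : (⟨d 0 v, Submodule.mem_map_of_mem hv⟩ :
          ↥(Submodule.map (d 0) (Vle Vx x 1))) = 0 := Subtype.ext hdv
      rw [h2, map_zero, add_zero] at h1
      exact h1
    | succ i =>
      have h1 := H1 i ⟨v, hv⟩
      have h2 : (⟨d (i + 1) v, hmem (i + 1) v hv⟩ : ↥(Vle Vx x (i + 1))) = 0 := Subtype.ext hdv
      rw [h2, map_zero, add_zero] at h1
      exact h1
  · intro i v hv
    rw [LinearMap.comp_apply, LinearMap.comp_apply, hP _ v hv, hP _ _ (hmem _ v hv)]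
    exact H1 i ⟨v, hv⟩
  · intro i z hz hr v hv
    rw [LinearMap.comp_apply, hP _ v (le_Vle hz _ hv)]
    exact H2 i z hz hr _ hv
  · intro i z hz v hv
    have h2 : (p (i + 1)).codRestrict (Vle Vx x (i + 1)) (hp (i + 1)) v = 0 :=
      Subtype.ext (hp0 (i + 1) z hz v hv)
    rw [LinearMap.comp_apply, h2, map_zero]

/-- Globally defined maps that satisfy the homotopy relations on `V_{≤ x}` give an
`L_{≤ x}`-homotopy; the map on the image of `∂_1` is determined by the others. -/
theorem HasLHomotopyOn.of_extension
    (hmem : ∀ (i : ℕ) (v : V (i + 1)), v ∈ Vle Vx x (i + 1) → d i v ∈ Vle Vx x i)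
    (h : ∀ i, V (i + 1) →ₗ[R] V (i + 2))
    (H0 : ∀ v ∈ Vle Vx x 1, d 0 v = 0 → d 1 (h 0 v) = v)
    (H1 : ∀ i, ∀ v ∈ Vle Vx x (i + 2), d (i + 2) (h (i + 1) v) + h i (d (i + 1) v) = v)
    (H2 : ∀ i z, z ≤ x → rk z = i + 1 → ∀ v ∈ Vx z (i + 1),
      h i v ∈ ⨆ y ∈ {y : L | z ⋖ y ∧ y ≤ x}, Vx y (i + 2)) :
    HasLHomotopyOn rk d Vx x := by
  let g : Vle Vx x 1 →ₗ[R] Submodule.map (d 0) (Vle Vx x 1) :=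
    ((d 0).domRestrict (Vle Vx x 1)).codRestrict _ fun v => Submodule.mem_map_of_mem v.2
  let f : Vle Vx x 1 →ₗ[R] V 1 :=
    (LinearMap.id - d 1 ∘ₗ h 0).domRestrict (Vle Vx x 1)
  have hg : Function.Surjective g := by
    rintro ⟨_, v, hv, rfl⟩
    exact ⟨⟨v, hv⟩, rfl⟩
  have hker : LinearMap.ker g ≤ LinearMap.ker f := by
    intro v hv
    have hv' : d 0 v.1 = 0 := congrArg Subtype.val (LinearMap.mem_ker.1 hv)
    have h1 := H0 v.1 v.2 hv'
    simp [f, h1]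
  refine ⟨hmem, (LinearMap.ker g).liftQ f hker ∘ₗ (g.quotKerEquivOfSurjective hg).symm.toLinearMap,
    fun i => (h i).domRestrict _, fun v => ?_, fun i v => H1 i v.1 v.2,
    fun i z hz hr v hv => H2 i z hz hr v.1 hv⟩
  have h1 : (g.quotKerEquivOfSurjective hg).symm
      ⟨d 0 v.1, Submodule.mem_map_of_mem v.2⟩ = Submodule.Quotient.mk v := by
    rw [LinearEquiv.symm_apply_eq]
    rfl
  rw [LinearMap.comp_apply, LinearEquiv.coe_coe, h1, Submodule.liftQ_apply]
  simp [f]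

/-- Homotopies on the subcomplexes `V_{≤ m}`, `m ∈ S`, glue in degrees `> k`, provided that
no element of rank at least `k` lies below two distinct elements of `S`. -/
theorem exists_glued_homotopy [DecidableEq L]
    (hrank : ∀ (x : L) (i : ℕ), i ≠ rk x → Vx x i = ⊥)
    (hint : ∀ i : ℕ, DirectSum.IsInternal (fun x : L => Vx x i))
    (S : Finset L) (k : ℕ)
    (hS : ∀ m ∈ S, ∀ m' ∈ S, ∀ z, k ≤ rk z → z ≤ m → z ≤ m' → m = m')
    (hh : ∀ m ∈ S, HasLHomotopyOn rk d Vx m) :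
    ∃ H : ∀ i, V (k + i + 1) →ₗ[R] V (k + i + 2),
      (∀ v ∈ ⨆ m ∈ S, Vle Vx m (k + 1), d k v = 0 → d (k + 1) (H 0 v) = v) ∧
      (∀ i, ∀ v ∈ ⨆ m ∈ S, Vle Vx m (k + i + 2),
        d (k + i + 2) (H (i + 1) v) + H i (d (k + i + 1) v) = v) ∧
      (∀ i, ∀ m ∈ S, ∀ z ≤ m, rk z = k + i + 1 → ∀ v ∈ Vx z (k + i + 1),
        H i v ∈ ⨆ y ∈ {y : L | z ⋖ y ∧ y ≤ m}, Vx y (k + i + 2)) := by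
  have hmem : ∀ m ∈ S, ∀ (i : ℕ) (v : V (i + 1)), v ∈ Vle Vx m (i + 1) → d i v ∈ Vle Vx m i :=
    fun m hm => (hh m hm).1
  choose! h h0 h1 h2 h3 using fun m hm => (hh m hm).exists_extension hint
  choose p hp hpid hp0 using fun (m : L) i => (hint i).exists_proj {y | y ≤ m}
  have hvan : ∀ m ∈ S, ∀ m' ∈ S, m ≠ m' → ∀ i {N : Type _} [AddCommGroup N] [Module R N]
      (f : V (k + i) →ₗ[R] N), (∀ z, ¬ z ≤ m → ∀ v ∈ Vx z (k + i), f v = 0) →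
      ∀ v ∈ Vle Vx m' (k + i), f v = 0 := by
    intro m hm m' hm' hne i N _ _ f hf v hv
    refine (iSup₂_le fun z hz w hw => ?_ :
      Vle Vx m' (k + i) ≤ LinearMap.ker f) hv
    by_cases hr : k + i = rk z
    · exact hf z (fun hzm => hne (hS m hm m' hm' z (by omega) hzm hz)) w hw
    · rw [hrank z _ hr, Submodule.mem_bot] at hw
      rw [hw]
      exact zero_mem _
  let H : ∀ i, V (k + i + 1) →ₗ[R] V (k + i + 2) := fun i => ∑ m ∈ S, h m (k + i)
  have hH : ∀ i, ∀ m ∈ S, ∀ v ∈ Vle Vx m (k + i + 1), H i v = h m (k + i) v := by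
    intro i m hm v hv
    simp only [H, LinearMap.sum_apply]
    refine Finset.sum_eq_single_of_mem m hm fun m' hm' hne => ?_
    exact hvan m' hm' m hm hne (i + 1) (h m' (k + i)) (h3 m' hm' (k + i)) v hv
  have hpother : ∀ i, ∀ m ∈ S, ∀ m' ∈ S, m ≠ m' → ∀ v ∈ Vle Vx m' (k + i),
      p m (k + i) v = 0 :=
    fun i m hm m' hm' hne => hvan m hm m' hm' hne i (p m (k + i)) (hp0 m (k + i))
  have hsum : ∀ i, ∀ v ∈ ⨆ m ∈ S, Vle Vx m (k + i), ∑ m ∈ S, p m (k + i) v = v := by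
    intro i v hv
    have hle : ⨆ m ∈ S, Vle Vx m (k + i) ≤
        LinearMap.eqLocus (∑ m ∈ S, p m (k + i)) LinearMap.id := by
      refine iSup₂_le fun m hm w hw => ?_
      rw [LinearMap.mem_eqLocus, LinearMap.sum_apply, LinearMap.id_apply,
        Finset.sum_eq_single_of_mem m hm fun m' hm' hne => hpother i m' hm' m hm hne w hw]
      exact hpid m _ w hw
    simpa using hle hv
  refine ⟨H, ?_, ?_, ?_⟩
  · intro v hv hdv
    have hcomm : ∀ m ∈ S, d k (p m (k + 1) v) = p m k (d k v) := by
      intro m hm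
      have hle : ⨆ m ∈ S, Vle Vx m (k + 1) ≤
          LinearMap.eqLocus (d k ∘ₗ p m (k + 1)) (p m k ∘ₗ d k) := by
        refine iSup₂_le fun m' hm' w hw => ?_
        rw [LinearMap.mem_eqLocus, LinearMap.comp_apply, LinearMap.comp_apply]
        by_cases hmm : m = m'
        · subst hmm
          rw [hpid m _ w hw, hpid m _ _ (hmem m hm k w hw)]
        · rw [hpother 1 m hm m' hm' hmm w hw, map_zero]
          exact (hpother 0 m hm m' hm' hmm _ (hmem m' hm' k w hw)).symm
      exact hle hv
    have hv1 := hsum 1 v hv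
    calc d (k + 1) (H 0 v) = d (k + 1) (H 0 (∑ m ∈ S, p m (k + 1) v)) := by rw [hv1]
      _ = ∑ m ∈ S, d (k + 1) (H 0 (p m (k + 1) v)) := by rw [map_sum, map_sum]
      _ = ∑ m ∈ S, p m (k + 1) v := by
          refine Finset.sum_congr rfl fun m hm => ?_
          rw [hH 0 m hm _ (hp m (k + 1) v)]
          refine h0 m hm k _ (hp m (k + 1) v) ?_
          rw [hcomm m hm, hdv, map_zero]
      _ = v := hv1
  · intro i v hv
    have hle : ⨆ m ∈ S, Vle Vx m (k + i + 2) ≤ LinearMap.eqLocus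
        (d (k + i + 2) ∘ₗ H (i + 1) + H i ∘ₗ d (k + i + 1)) LinearMap.id := by
      refine iSup₂_le fun m hm w hw => ?_
      rw [LinearMap.mem_eqLocus, LinearMap.add_apply, LinearMap.comp_apply, LinearMap.comp_apply,
        hH (i + 1) m hm w hw, hH i m hm _ (hmem m hm _ w hw)]
      exact h1 m hm (k + i) w hw
    exact hle hv
  · intro i m hm z hz hr v hv
    rw [hH i m hm v (le_Vle hz _ hv)]
    exact h2 m hm (k + i) z hz hr v hv

end Homotopies

/-- Truncation of an `L`-contractible compatibly `L`-graded complex along a non-degenerate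
`k`-th truncation `l : L_{≥k} → Λ` yields a compatibly `Λ`-graded, `Λ`-contractible complex
`V^{(k)}` with `V^{(k)}_i = V_{k+i}` and `V^{(k)}_λ = ⊕_{l(x) = λ} V_x`. -/
theorem stmt14 {L Λ : Type*} [Lattice L] [Fintype L] [DecidableEq L] [BoundedOrder L]
    [Lattice Λ] [Fintype Λ] [DecidableEq Λ] [BoundedOrder Λ]
    (hatomL : Atomistic L) (hsemiL : Semimodular L)
    (hatomΛ : Atomistic Λ) (hsemiΛ : Semimodular Λ)
    (rkL : L → ℕ) (hrkL : IsRankFunction rkL)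
    (rkΛ : Λ → ℕ) (hrkΛ : IsRankFunction rkΛ)
    (k : ℕ) (hk : k ≤ rkL ⊤)
    (l : {x : L // k ≤ rkL x} → Λ)
    (hmono : ∀ x y : {x : L // k ≤ rkL x}, x.1 ≤ y.1 → l x ≤ l y)
    (hlrank : ∀ x : {x : L // k ≤ rkL x}, rkΛ (l x) = rkL x.1 - k)
    (hljoin : ∀ x y z : {x : L // k ≤ rkL x}, z.1 = x.1 ⊔ y.1 →
      k ≤ rkL (x.1 ⊓ y.1) → l z = l x ⊔ l y)
    {R : Type*} [Ring R] (V : ℕ → Type*) [∀ i, AddCommGroup (V i)] [∀ i, Module R (V i)]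
    (d : ∀ i, V (i + 1) →ₗ[R] V i) (Vx : L → ∀ i, Submodule R (V i))
    (hgr : IsCompatGrading rkL V d Vx)
    (hcontr : LContractible rkL d Vx) :
    IsCompatGrading rkΛ (fun i => V (k + i)) (fun i => d (k + i))
      (fun lam i => ⨆ x : {x : L // k ≤ rkL x}, ⨆ _ : l x = lam, Vx x.1 (k + i)) ∧
    LContractible rkΛ (V := fun i => V (k + i)) (fun i => d (k + i))
      (fun lam i => ⨆ x : {x : L // k ≤ rkL x}, ⨆ _ : l x = lam, Vx x.1 (k + i)) := by
  classical
  obtain ⟨hd, hrank, hint, hdiff⟩ := hgr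
  have hrm := hrkL.strictMono_s14
  have hcov : ∀ x y : {x : L // k ≤ rkL x}, x.1 ⋖ y.1 → l x ⋖ l y := by
    intro x y hxy
    refine hrkΛ.covBy_of_le_s14 (hmono x y hxy.le) ?_
    have h1 := hrkL.2 _ _ hxy
    have h2 := x.2
    rw [hlrank, hlrank]
    omega
  have hpiece : ∀ (lam : Λ) (i : ℕ) (x : {x : L // k ≤ rkL x}), l x = lam →
      Vx x.1 (k + i) ≤ ⨆ x : {x : L // k ≤ rkL x}, ⨆ _ : l x = lam, Vx x.1 (k + i) :=
    fun lam i x hx => le_iSup₂_of_le x hx le_rfl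
  refine ⟨⟨fun i v => hd (k + i) v, ?_, ?_, ?_⟩, ?_⟩
  · intro lam i hi
    refine eq_bot_iff.2 (iSup₂_le fun x hx => ?_)
    rw [hrank x.1 (k + i) fun h => hi ?_]
    rw [← hx, hlrank, ← h]
    omega
  · intro i
    exact (hint (k + i)).fiberwise (fun x hx => hrank x (k + i) (by omega)) l
  · intro i lam hlam
    rw [Submodule.map_le_iff_le_comap]
    refine iSup₂_le fun x hx => ?_
    rw [← Submodule.map_le_iff_le_comap]
    have hrx : rkL x.1 = k + i + 1 := by
      have h1 := hlrank x
      rw [hx] at h1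
      omega
    refine (hdiff (k + i) x.1 hrx).trans (iSup₂_le fun y hy => ?_)
    have hry : k ≤ rkL y := by
      have h1 := hrkL.2 y x.1 hy
      omega
    have hly : l ⟨y, hry⟩ ⋖ lam := hx ▸ hcov ⟨y, hry⟩ x hy
    exact le_iSup₂_of_le (l ⟨y, hry⟩) hly (hpiece _ i ⟨y, hry⟩ rfl)
  · intro lam
    let S : Finset L := Finset.univ.filter fun m =>
      ∃ hm : k ≤ rkL m, Maximal (fun x => l x ≤ lam) (⟨m, hm⟩ : {x : L // k ≤ rkL x})
    have hSmem : ∀ m, m ∈ S ↔ ∃ hm : k ≤ rkL m,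
        Maximal (fun x => l x ≤ lam) (⟨m, hm⟩ : {x : L // k ≤ rkL x}) := fun m => by simp [S]
    have hSex : ∀ x : {x : L // k ≤ rkL x}, l x ≤ lam → ∃ m ∈ S, x.1 ≤ m := by
      intro x hx
      obtain ⟨m, hxm, hm⟩ :=
        (Set.toFinite {x : {x : L // k ≤ rkL x} | l x ≤ lam}).exists_le_maximal hx
      exact ⟨m.1, (hSmem _).2 ⟨m.2, hm⟩, hxm⟩
    have hSle : ∀ m ∈ S, ∀ y (hy : k ≤ rkL y), y ≤ m → l ⟨y, hy⟩ ≤ lam := by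
      intro m hm y hy hym
      obtain ⟨hkm, hmax⟩ := (hSmem m).1 hm
      exact (hmono ⟨y, hy⟩ ⟨m, hkm⟩ hym).trans hmax.1
    have hSle' : ∀ m ∈ S, ∀ m' ∈ S, ∀ z, k ≤ rkL z → z ≤ m → z ≤ m' → m' ≤ m := by
      intro m hm m' hm' z hz hzm hzm'
      obtain ⟨hkm, hmax⟩ := (hSmem m).1 hm
      obtain ⟨hkm', hmax'⟩ := (hSmem m').1 hm'
      have hksup : k ≤ rkL (m ⊔ m') := hkm.trans (hrm.monotone le_sup_left)
      have hkinf : k ≤ rkL (m ⊓ m') := hz.trans (hrm.monotone (le_inf hzm hzm'))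
      have hl := hljoin ⟨m, hkm⟩ ⟨m', hkm'⟩ ⟨m ⊔ m', hksup⟩ rfl hkinf
      have hle : m ⊔ m' ≤ m := hmax.2 (y := ⟨m ⊔ m', hksup⟩)
        (hl.trans_le (sup_le hmax.1 hmax'.1)) (le_sup_left : m ≤ m ⊔ m')
      exact le_sup_right.trans hle
    obtain ⟨H, H0, H1, H2⟩ := exists_glued_homotopy (d := d) hrank hint S k
      (fun m hm m' hm' z hz hzm hzm' =>
        le_antisymm (hSle' m' hm' m hm z hz hzm' hzm) (hSle' m hm m' hm' z hz hzm hzm'))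
      (fun m _ => hcontr m)
    have hVle : ∀ i, Vle (V := fun i => V (k + i))
        (fun lam i => ⨆ x : {x : L // k ≤ rkL x}, ⨆ _ : l x = lam, Vx x.1 (k + i)) lam i =
        ⨆ m ∈ S, Vle Vx m (k + i) := by
      intro i
      apply le_antisymm
      · refine iSup₂_le fun mu hmu => iSup₂_le fun x hx => ?_
        obtain ⟨m, hm, hxm⟩ := hSex x (hx.trans_le hmu)
        exact le_iSup₂_of_le m hm (le_Vle hxm _)
      · refine iSup₂_le fun m hm => iSup₂_le fun y hy => ?_
        by_cases hr : k + i = rkL y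
        · have hky : k ≤ rkL y := by omega
          exact (hpiece _ i ⟨y, hky⟩ rfl).trans
            (le_Vle (V := fun i => V (k + i)) (Vx := fun lam i =>
              ⨆ x : {x : L // k ≤ rkL x}, ⨆ _ : l x = lam, Vx x.1 (k + i))
              (hSle m hm y hky hy) i)
        · rw [hrank y _ hr]
          exact bot_le
    refine HasLHomotopyOn.of_extension (V := fun i => V (k + i)) ?_ H ?_ ?_ ?_
    · intro i v hv
      rw [hVle] at hv ⊢
      refine (iSup₂_le fun m hm w hw => ?_ : ⨆ m ∈ S, Vle Vx m (k + i + 1) ≤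
        (⨆ m ∈ S, Vle Vx m (k + i)).comap (d (k + i))) hv
      exact Submodule.mem_iSup_of_mem m
        (Submodule.mem_iSup_of_mem hm ((hcontr m).1 (k + i) w hw))
    · intro v hv hdv
      rw [hVle] at hv
      exact H0 v hv hdv
    · intro i v hv
      rw [hVle] at hv
      exact H1 i v hv
    · intro i mu hmu hr v hv
      refine (iSup₂_le fun x hx w hw => ?_ :
        (⨆ x : {x : L // k ≤ rkL x}, ⨆ _ : l x = mu, Vx x.1 (k + (i + 1))) ≤
        (⨆ nu ∈ {nu : Λ | mu ⋖ nu ∧ nu ≤ lam},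
          ⨆ x : {x : L // k ≤ rkL x}, ⨆ _ : l x = nu, Vx x.1 (k + (i + 2))).comap (H i)) hv
      have hrx : rkL x.1 = k + i + 1 := by
        have h1 := hlrank x
        rw [hx] at h1
        omega
      obtain ⟨m, hm, hxm⟩ := hSex x (hx.trans_le hmu)
      rw [Submodule.mem_comap]
      refine (iSup₂_le fun y hy => ?_ : (_ : Submodule R (V (k + i + 2))) ≤ _)
        (H2 i m hm x.1 hxm hrx w hw)
      have hky : k ≤ rkL y := x.2.trans (hrm.monotone hy.1.le)
      have hly : mu ⋖ l ⟨y, hky⟩ := hx ▸ hcov x ⟨y, hky⟩ hy.1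
      exact le_iSup₂_of_le (l ⟨y, hky⟩) ⟨hly, hSle m hm y hky hy.2⟩
        (hpiece _ (i + 2) ⟨y, hky⟩ rfl)
end
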